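/- arXiv:1503.05913 — 13 statements merged into one kernel-verified Lean document; each statement's English description precedes it below -/
import Mathlib

section
/- Let L ∈ ℝ^{n×n} be the Laplacian of a weighted directed graph on n vertices and fix a Jordan decomposition P^{−1} L P = J = diag(J_0, J_1, …, J_s) of L with last-row indices m_0, m_1, …, m_s and P^{−1} = (η¹, …, ηⁿ) written by columns. Then there exists a single leader index i ∈ {1,…,n} such that the pair (L, e_i) is controllable if and only if both of the following hold: (1) L is cyclic; (2) there exists a column η^i of P^{−1} such that η^i_{m_j} ≠ 0 for every j = 0, 1, …, s. Moreover, in that case the pair (L, e_i) is controllable exactly when the index i is one whose column η^i satisfies condition (2). -/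
open Matrix

/-- The controllability matrix `(b, Lb, L²b, …, L^{n−1}b)` of a single-input pair `(L, b)`. -/
noncomputable def ctrbMat {n : ℕ} (L : Matrix (Fin n) (Fin n) ℝ) (b : Fin n → ℝ) :
    Matrix (Fin n) (Fin n) ℝ :=
  Matrix.of fun i k => ((L ^ (k : ℕ)).mulVec b) i

open Polynomial

theorem Matrix.rank_eq_iff_det_ne_zero {K : Type*} [Field K] {n : ℕ}
    (A : Matrix (Fin n) (Fin n) K) : A.rank = n ↔ A.det ≠ 0 := by
  constructor
  · intro h
    have htop : LinearMap.range A.mulVecLin = ⊤ :=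
      Submodule.eq_top_of_finrank_eq (by rw [Module.finrank_fin_fun]; exact h)
    have hsurj : Function.Surjective A.mulVec := LinearMap.range_eq_top.1 htop
    exact ((Matrix.isUnit_iff_isUnit_det A).1
      (Matrix.mulVec_surjective_iff_isUnit.1 hsurj)).ne_zero
  · intro h
    simpa using A.rank_of_isUnit ((Matrix.isUnit_iff_isUnit_det A).2 h.isUnit)

theorem Matrix.aeval_transpose {R m : Type*} [CommRing R] [Fintype m] [DecidableEq m]
    (A : Matrix m m R) (p : R[X]) : aeval Aᵀ p = (aeval A p)ᵀ := by
  simp only [aeval_eq_sum_range, Matrix.transpose_sum, Matrix.transpose_smul,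
    Matrix.transpose_pow]

theorem Matrix.inv_mul_mul_pow {R m : Type*} [CommRing R] [Fintype m] [DecidableEq m]
    {P : Matrix m m R} (hP : IsUnit P.det) (A : Matrix m m R) (k : ℕ) :
    (P⁻¹ * A * P) ^ k = P⁻¹ * A ^ k * P := by
  induction k with
  | zero => simp [Matrix.nonsing_inv_mul P hP]
  | succ k ih =>
    rw [pow_succ, ih, pow_succ]
    simp only [Matrix.mul_assoc, Matrix.mul_nonsing_inv_cancel_left P _ hP]

theorem Matrix.aeval_inv_mul_mul {R m : Type*} [CommRing R] [Fintype m] [DecidableEq m]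
    {P : Matrix m m R} (hP : IsUnit P.det) (A : Matrix m m R) (p : R[X]) :
    aeval (P⁻¹ * A * P) p = P⁻¹ * aeval A p * P := by
  simp only [aeval_eq_sum_range, Matrix.inv_mul_mul_pow hP, Matrix.mul_sum, Matrix.sum_mul,
    Matrix.mul_smul, Matrix.smul_mul]

/-- A polynomial of degree at most `rank (f - μ) + 1` annihilates `f`: the characteristic
polynomial of `f` on the range of `f - μ`, times `X - μ`. -/
theorem Module.End.exists_monic_aeval_eq_zero {K V : Type*} [Field K] [AddCommGroup V]
    [Module K V] [FiniteDimensional K V] (f : Module.End K V) (μ : K) :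
    ∃ p : K[X], p.Monic ∧
      p.natDegree = Module.finrank K (LinearMap.range (f - algebraMap K _ μ)) + 1 ∧
      aeval f p = 0 := by
  set g := f - algebraMap K (Module.End K V) μ with hg
  have hcomm : Commute f g := (Commute.refl f).sub_right (Algebra.commute_algebraMap_right μ f)
  have hmaps : ∀ x ∈ LinearMap.range g, f x ∈ LinearMap.range g := by
    rintro _ ⟨y, rfl⟩
    exact ⟨f y, (LinearMap.congr_fun hcomm.eq y).symm⟩
  set h : Module.End K (LinearMap.range g) := f.restrict hmaps
  have hpow : ∀ (k : ℕ) (x : LinearMap.range g), ((h ^ k) x : V) = (f ^ k) x := by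
    intro k
    induction k with
    | zero => simp
    | succ k ih => intro x; rw [pow_succ, pow_succ, Module.End.mul_apply, ih]; rfl
  have haeval : ∀ (q : K[X]) (x : LinearMap.range g), (aeval h q x : V) = aeval f q x := by
    intro q x
    simp [aeval_eq_sum_range, LinearMap.sum_apply, hpow]
  refine ⟨h.charpoly * (X - C μ), h.charpoly_monic.mul (monic_X_sub_C μ), ?_, ?_⟩
  · rw [h.charpoly_monic.natDegree_mul (monic_X_sub_C μ), natDegree_X_sub_C,
      h.charpoly_natDegree]
  · ext x
    have hx := haeval h.charpoly ⟨g x, x, rfl⟩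
    rw [h.aeval_self_charpoly] at hx
    simpa [hg] using hx.symm

theorem Matrix.minpoly_natDegree_le_of_aeval_map_ofReal {m : Type*} [Fintype m] [DecidableEq m]
    (A : Matrix m m ℝ) {p : ℂ[X]} (hp : p.Monic)
    (h : aeval (A.map (fun x : ℝ => (x : ℂ))) p = 0) :
    (minpoly ℝ A).natDegree ≤ p.natDegree := by
  set q : ℝ[X] := ∑ k ∈ Finset.range (p.natDegree + 1), C (p.coeff k).re * X ^ k with hq
  have hdeg : q.natDegree ≤ p.natDegree :=
    natDegree_sum_le_of_forall_le _ _ fun k hk =>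
      (natDegree_C_mul_X_pow_le _ _).trans (Nat.lt_succ_iff.1 (Finset.mem_range.1 hk))
  have hcoeff : q.coeff p.natDegree = 1 := by
    simp [hq, coeff_C_mul, coeff_X_pow, hp.coeff_natDegree]
  have hq0 : q ≠ 0 := by
    rintro h0
    simp [h0] at hcoeff
  have hpow : ∀ k : ℕ, A.map (fun x : ℝ => (x : ℂ)) ^ k = (A ^ k).map (fun x : ℝ => (x : ℂ)) :=
    fun k => (Matrix.map_pow A Complex.ofRealHom k).symm
  have hann : aeval A q = 0 := by
    ext i j
    have hij := congrArg Complex.re (congrFun (congrFun h i) j)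
    rw [aeval_eq_sum_range] at hij
    simp only [hpow, Matrix.sum_apply, Matrix.smul_apply, Matrix.map_apply, smul_eq_mul,
      Complex.re_sum, Complex.re_mul_ofReal, Matrix.zero_apply, Complex.zero_re] at hij
    simpa [hq, Matrix.sum_apply, Matrix.algebraMap_eq_diagonal, ← Algebra.smul_def] using hij
  exact (natDegree_le_of_dvd (minpoly.dvd ℝ A hann) hq0).trans hdeg

/-- The left eigenspaces of a matrix similar to a cyclic real matrix are lines. -/
theorem Matrix.exists_smul_eq_of_cyclic {n : ℕ} {L : Matrix (Fin n) (Fin n) ℝ}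
    (hcyc : L.charpoly = minpoly ℝ L) {P : Matrix (Fin n) (Fin n) ℂ} (hP : IsUnit P.det)
    {J : Matrix (Fin n) (Fin n) ℂ} (hJ : P⁻¹ * (L.map (fun x : ℝ => (x : ℂ))) * P = J)
    {μ : ℂ} {u v : Fin n → ℂ} (hu : u ≠ 0) (huJ : u ᵥ* J = μ • u) (hvJ : v ᵥ* J = μ • v) :
    ∃ c : ℂ, c • u = v := by
  set f : Module.End ℂ (Fin n → ℂ) := Matrix.toLinAlgEquiv' Jᵀ with hf
  obtain ⟨p, hp, hdeg, hpf⟩ := f.exists_monic_aeval_eq_zero μ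
  have hpJ : aeval Jᵀ p = 0 := by
    rw [hf, aeval_algHom_apply] at hpf
    exact (map_eq_zero_iff _ Matrix.toLinAlgEquiv'.injective).1 hpf
  rw [Matrix.aeval_transpose, Matrix.transpose_eq_zero, ← hJ, Matrix.aeval_inv_mul_mul hP] at hpJ
  have hpL : aeval (L.map (fun x : ℝ => (x : ℂ))) p = 0 := by
    have := congrArg (fun M => P * M * P⁻¹) hpJ
    simpa [Matrix.mul_assoc, Matrix.mul_nonsing_inv_cancel_left P _ hP,
      Matrix.mul_nonsing_inv P hP] using this
  have hle := L.minpoly_natDegree_le_of_aeval_map_ofReal hp hpL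
  rw [← hcyc, Matrix.charpoly_natDegree_eq_dim, Fintype.card_fin] at hle
  have hrn := LinearMap.finrank_range_add_finrank_ker (f - algebraMap ℂ _ μ)
  rw [Module.finrank_fin_fun] at hrn
  have hker : Module.finrank ℂ (LinearMap.ker (f - algebraMap ℂ _ μ)) ≤ 1 := by omega
  have hmem : ∀ x : Fin n → ℂ, x ᵥ* J = μ • x → x ∈ LinearMap.ker (f - algebraMap ℂ _ μ) := by
    intro x hx
    simp [hf, Matrix.mulVec_transpose, hx]
  obtain ⟨x, hx⟩ := finrank_le_one_iff.1 hker
  obtain ⟨a, ha⟩ := hx ⟨u, hmem u huJ⟩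
  obtain ⟨b, hb⟩ := hx ⟨v, hmem v hvJ⟩
  have ha' : a • (x : Fin n → ℂ) = u := congrArg Subtype.val ha
  have hb' : b • (x : Fin n → ℂ) = v := congrArg Subtype.val hb
  have ha0 : a ≠ 0 := by
    rintro rfl
    exact hu (by rw [← ha', zero_smul])
  exact ⟨b / a, by rw [← ha', ← hb', smul_smul, div_mul_cancel₀ _ ha0]⟩

/-- A vector orthogonal to the first `n` Krylov vectors of `b` forces a left eigenvector
orthogonal to `b`. -/
theorem Matrix.exists_left_eigenvector_dotProduct_eq_zero {n : ℕ}
    (J : Matrix (Fin n) (Fin n) ℂ) (b v : Fin n → ℂ) (hv : v ≠ 0)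
    (hvb : ∀ k < n, v ⬝ᵥ (J ^ k *ᵥ b) = 0) :
    ∃ (μ : ℂ) (u : Fin n → ℂ), u ≠ 0 ∧ u ᵥ* J = μ • u ∧ u ⬝ᵥ b = 0 := by
  have hn : 0 < n := by
    rcases Nat.eq_zero_or_pos n with rfl | h
    · exact absurd (Subsingleton.elim _ _) hv
    · exact h
  let W : Submodule ℂ (Fin n → ℂ) :=
    { carrier := {x | ∀ k : ℕ, x ⬝ᵥ (J ^ k *ᵥ b) = 0}
      add_mem' := fun hx hy k => by rw [add_dotProduct, hx k, hy k, add_zero]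
      zero_mem' := fun k => zero_dotProduct _
      smul_mem' := fun c x hx k => by rw [smul_dotProduct, hx k, smul_zero] }
  have hvW : v ∈ W := by
    intro k
    have hlt : (X ^ k %ₘ J.charpoly).natDegree < n := by
      have h1 : J.charpoly ≠ 1 := by
        intro h
        have := J.charpoly_natDegree_eq_dim
        rw [h, natDegree_one, Fintype.card_fin] at this
        omega
      simpa [J.charpoly_natDegree_eq_dim] using
        natDegree_modByMonic_lt (X ^ k) J.charpoly_monic h1
    rw [J.pow_eq_aeval_mod_charpoly, aeval_eq_sum_range' hlt, Matrix.sum_mulVec, dotProduct_sum]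
    refine Finset.sum_eq_zero fun l hl => ?_
    rw [Matrix.smul_mulVec, dotProduct_smul, hvb l (Finset.mem_range.1 hl), smul_zero]
  have hmaps : ∀ x ∈ W, J.vecMulLinear x ∈ W := by
    intro x hx k
    rw [Matrix.vecMulLinear_apply, ← Matrix.dotProduct_mulVec, Matrix.mulVec_mulVec, ← pow_succ']
    exact hx (k + 1)
  have : Nontrivial W := ⟨⟨⟨v, hvW⟩, 0, fun h => hv (congrArg Subtype.val h)⟩⟩
  obtain ⟨μ, hμ⟩ := Module.End.exists_eigenvalue (J.vecMulLinear.restrict hmaps)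
  obtain ⟨u, hu⟩ := hμ.exists_hasEigenvector
  refine ⟨μ, u, fun h => hu.2 (Subtype.ext h), congrArg Subtype.val hu.apply_eq_smul, ?_⟩
  simpa using u.2 0

section JordanForm

variable {n : ℕ} {J : Matrix (Fin n) (Fin n) ℂ} {d t : Fin n → ℂ}

theorem vecMul_jordan_zero
    (hJ : ∀ i j, J i j = if j = i then d i else if (j : ℕ) = (i : ℕ) + 1 then t i else 0)
    (v : Fin n → ℂ) (j : Fin n) (hj : (j : ℕ) = 0) : (v ᵥ* J) j = v j * d j := by
  rw [Matrix.vecMul, dotProduct, Finset.sum_eq_single j]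
  · simp [hJ]
  · intro i _ hij
    rw [hJ, if_neg hij.symm, if_neg (by omega), mul_zero]
  · simp

theorem vecMul_jordan_succ
    (hJ : ∀ i j, J i j = if j = i then d i else if (j : ℕ) = (i : ℕ) + 1 then t i else 0)
    (v : Fin n → ℂ) (i j : Fin n) (hj : (j : ℕ) = (i : ℕ) + 1) :
    (v ᵥ* J) j = v j * d j + v i * t i := by
  have hne : j ≠ i := fun h => by simp [h] at hj
  rw [Matrix.vecMul, dotProduct, Finset.sum_eq_add_of_mem j i (Finset.mem_univ _)
    (Finset.mem_univ _) hne]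
  · simp [hJ, hj, hne]
  · rintro k - ⟨hkj, hki⟩
    rw [hJ, if_neg hkj.symm, if_neg (fun h => hki (Fin.ext (by omega))), mul_zero]

theorem single_vecMul_jordan
    (hJ : ∀ i j, J i j = if j = i then d i else if (j : ℕ) = (i : ℕ) + 1 then t i else 0)
    {m : Fin n} (hm : (m : ℕ) = n - 1 ∨ t m = 0) :
    (Pi.single m 1 : Fin n → ℂ) ᵥ* J = d m • Pi.single m 1 := by
  ext j
  rw [Matrix.single_one_vecMul, Matrix.row_apply, hJ]
  by_cases hjm : j = m
  · subst hjm
    simp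
  · have : ¬ ((j : ℕ) = (m : ℕ) + 1 ∧ t m ≠ 0) := by
      rintro ⟨h1, h2⟩
      rcases hm with hm | hm
      · have := j.isLt
        omega
      · exact h2 hm
    simp only [if_neg hjm, Pi.smul_apply, Pi.single_apply, smul_zero]
    by_cases h1 : (j : ℕ) = (m : ℕ) + 1
    · simpa [h1] using this
    · simp [h1]

/-- A left eigenvector of a Jordan matrix is supported on last rows of Jordan blocks. -/
theorem jordan_left_eigenvector_support
    (hJ : ∀ i j, J i j = if j = i then d i else if (j : ℕ) = (i : ℕ) + 1 then t i else 0)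
    (hblk : ∀ i j : Fin n, (j : ℕ) = (i : ℕ) + 1 → t i = 1 → d j = d i)
    (ht01 : ∀ i, t i = 0 ∨ t i = 1)
    {μ : ℂ} {u : Fin n → ℂ} (hu : u ᵥ* J = μ • u) {m : Fin n} (hm : u m ≠ 0) :
    d m = μ ∧ ((m : ℕ) = n - 1 ∨ t m = 0) := by
  have hd : ∀ (k : ℕ) (j : Fin n), (j : ℕ) = k → u j ≠ 0 → d j = μ := by
    intro k
    induction k with
    | zero =>
      intro j hj huj
      have h := congrFun hu j
      rw [vecMul_jordan_zero hJ u j hj, Pi.smul_apply, smul_eq_mul, mul_comm] at h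
      exact mul_right_cancel₀ huj h
    | succ k ih =>
      intro j hj huj
      let i : Fin n := ⟨k, by have := j.isLt; omega⟩
      have h := congrFun hu j
      rw [vecMul_jordan_succ hJ u i j hj, Pi.smul_apply, smul_eq_mul] at h
      by_cases hi : u i * t i = 0
      · rw [hi, add_zero, mul_comm] at h
        exact mul_right_cancel₀ huj h
      · have hti : t i = 1 := (ht01 i).resolve_left (right_ne_zero_of_mul hi)
        rw [hblk i j hj hti]
        exact ih i rfl (left_ne_zero_of_mul hi)
  refine ⟨hd m m rfl hm, ?_⟩
  by_cases hlast : (m : ℕ) = n - 1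
  · exact Or.inl hlast
  · right
    let j : Fin n := ⟨m + 1, by have := m.isLt; omega⟩
    have h := congrFun hu j
    rw [vecMul_jordan_succ hJ u m j rfl, Pi.smul_apply, smul_eq_mul] at h
    have hj : u j * d j = μ * u j := by
      by_cases huj : u j = 0
      · simp [huj]
      · rw [hd j j rfl huj, mul_comm]
    rw [hj, add_eq_left] at h
    exact (mul_eq_zero.1 h).resolve_left hm

end JordanForm

theorem cyclic_of_ctrbMat_det_ne_zero {n : ℕ} {L : Matrix (Fin n) (Fin n) ℝ} {b : Fin n → ℝ}
    (h : (ctrbMat L b).det ≠ 0) : L.charpoly = minpoly ℝ L := by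
  have hmonic : (minpoly ℝ L).Monic := minpoly.monic (Matrix.isIntegral L)
  refine eq_of_monic_of_dvd_of_natDegree_le hmonic L.charpoly_monic L.minpoly_dvd_charpoly ?_
  rw [L.charpoly_natDegree_eq_dim, Fintype.card_fin]
  by_contra! hlt
  refine h (Matrix.exists_mulVec_eq_zero_iff.1
    ⟨fun k => (minpoly ℝ L).coeff k, fun h0 => ?_, ?_⟩)
  · have := congrFun h0 ⟨_, hlt⟩
    simp [hmonic.coeff_natDegree] at this
  · have hann : aeval L (minpoly ℝ L) *ᵥ b = 0 := by rw [minpoly.aeval, Matrix.zero_mulVec]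
    rw [aeval_eq_sum_range' hlt, Matrix.sum_mulVec, ← Fin.sum_univ_eq_sum_range
      (fun k => ((minpoly ℝ L).coeff k • L ^ k) *ᵥ b)] at hann
    rw [← hann]
    ext i
    simp [ctrbMat, Matrix.mulVec, dotProduct, Finset.sum_apply, Matrix.smul_mulVec, mul_comm,
      Finset.mul_sum]

/-- The controllability matrix of `(L, e_i)` in Jordan coordinates. -/
theorem inv_mul_ctrbMat_map {n : ℕ} (L : Matrix (Fin n) (Fin n) ℝ)
    {P : Matrix (Fin n) (Fin n) ℂ} (hP : IsUnit P.det) (i : Fin n) :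
    P⁻¹ * (ctrbMat L (Pi.single i 1)).map (fun x : ℝ => (x : ℂ)) =
      Matrix.of fun a k : Fin n =>
        ((P⁻¹ * (L.map (fun x : ℝ => (x : ℂ))) * P) ^ (k : ℕ) *ᵥ P⁻¹.col i) a := by
  have hpow : ∀ k : ℕ, L.map (fun x : ℝ => (x : ℂ)) ^ k = (L ^ k).map (fun x : ℝ => (x : ℂ)) :=
    fun k => (Matrix.map_pow L Complex.ofRealHom k).symm
  ext a k
  rw [Matrix.of_apply, Matrix.inv_mul_mul_pow hP, ← Matrix.mulVec_single_one P⁻¹ i,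
    Matrix.mulVec_mulVec, Matrix.mul_assoc, Matrix.mul_nonsing_inv P hP, Matrix.mul_one,
    ← Matrix.mulVec_mulVec, hpow, Matrix.mulVec_single_one]
  simp only [Matrix.mul_apply, ctrbMat, Matrix.mulVec_single_one]
  rfl

theorem ctrbMat_single_rank_eq_iff {n : ℕ} {L : Matrix (Fin n) (Fin n) ℝ}
    {P J : Matrix (Fin n) (Fin n) ℂ} {d t : Fin n → ℂ} (hP : IsUnit P.det)
    (hJ : ∀ i j, J i j = if j = i then d i else if (j : ℕ) = (i : ℕ) + 1 then t i else 0)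
    (ht01 : ∀ i, t i = 0 ∨ t i = 1)
    (hblk : ∀ i j : Fin n, (j : ℕ) = (i : ℕ) + 1 → t i = 1 → d j = d i)
    (hdecomp : P⁻¹ * (L.map (fun x : ℝ => (x : ℂ))) * P = J) (i : Fin n) :
    (ctrbMat L (Pi.single i 1)).rank = n ↔ L.charpoly = minpoly ℝ L ∧
      ∀ m : Fin n, ((m : ℕ) = n - 1 ∨ t m = 0) → P⁻¹ m i ≠ 0 := by
  set M : Matrix (Fin n) (Fin n) ℂ :=
    Matrix.of fun a k : Fin n => (J ^ (k : ℕ) *ᵥ P⁻¹.col i) a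
  have hMC : P⁻¹ * (ctrbMat L (Pi.single i 1)).map (fun x : ℝ => (x : ℂ)) = M := by
    rw [inv_mul_ctrbMat_map L hP, hdecomp]
  have hdet : M.det = P⁻¹.det * ((ctrbMat L (Pi.single i 1)).det : ℂ) := by
    rw [← hMC, Matrix.det_mul]
    exact congrArg _ (Complex.ofRealHom.map_det _).symm
  have hPinv : P⁻¹.det ≠ 0 := (Matrix.isUnit_nonsing_inv_det P hP).ne_zero
  have hvM : ∀ (v : Fin n → ℂ) (k : Fin n),
      (v ᵥ* M) k = v ⬝ᵥ (J ^ (k : ℕ) *ᵥ P⁻¹.col i) := fun v k => rfl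
  rw [Matrix.rank_eq_iff_det_ne_zero]
  constructor
  · refine fun h => ⟨cyclic_of_ctrbMat_det_ne_zero h, fun m hm h0 => ?_⟩
    have heig := single_vecMul_jordan hJ hm
    have hpow : ∀ k : ℕ, (Pi.single m 1 : Fin n → ℂ) ᵥ* J ^ k = d m ^ k • Pi.single m 1 := by
      intro k
      induction k with
      | zero => simp
      | succ k ih =>
        rw [pow_succ, ← Matrix.vecMul_vecMul, ih, Matrix.smul_vecMul, heig, smul_smul, pow_succ]
    have hzero : M.det = 0 := by
      refine Matrix.exists_vecMul_eq_zero_iff.1 ⟨Pi.single m 1, by simp, ?_⟩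
      ext k
      rw [hvM, Matrix.dotProduct_mulVec, hpow, smul_dotProduct, single_one_dotProduct,
        Matrix.col_apply, h0, smul_zero, Pi.zero_apply]
    rw [hdet, mul_eq_zero] at hzero
    exact h (by exact_mod_cast hzero.resolve_left hPinv)
  · rintro ⟨hcyc, hne⟩ h0
    have hzero : M.det = 0 := by rw [hdet, h0, Complex.ofReal_zero, mul_zero]
    obtain ⟨v, hv, hv0⟩ := Matrix.exists_vecMul_eq_zero_iff.2 hzero
    obtain ⟨μ, u, hu, huJ, hub⟩ := J.exists_left_eigenvector_dotProduct_eq_zero (P⁻¹.col i) v hv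
      (fun k hk => by rw [← hvM v ⟨k, hk⟩, hv0, Pi.zero_apply])
    obtain ⟨m, hm⟩ := Function.ne_iff.1 hu
    obtain ⟨hdm, hlast⟩ := jordan_left_eigenvector_support hJ hblk ht01 huJ hm
    obtain ⟨c, hc⟩ := Matrix.exists_smul_eq_of_cyclic hcyc hP hdecomp hu huJ
      (hdm ▸ single_vecMul_jordan hJ hlast)
    apply hne m hlast
    have := congrArg (fun x => x ⬝ᵥ P⁻¹.col i) hc
    simpa [hub] using this.symm

/-- **Single-leader controllability via the Jordan form of the Laplacian.**
Let `L` be the Laplacian of a weighted directed graph on `n` vertices (nonnegative weights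
`w i j` of the edges `j → i`, no self-loops), and fix a Jordan decomposition
`P⁻¹ L P = J` where `J` is encoded by its diagonal `d` and superdiagonal `t`
(`t i ∈ {0,1}`, and `t i = 1` forces equal neighbouring diagonal entries, so the Jordan
blocks are the maximal runs where `t = 1`; the last rows of the blocks are exactly the
indices `m` with `(m : ℕ) = n - 1` or `t m = 0`).  Then there is a single leader `i` making
`(L, e_i)` controllable iff (1) `L` is cyclic (charpoly = minimal polynomial) and
(2) some column `i` of `P⁻¹` has nonzero entries at all block-last rows; moreover, in that
case `(L, e_i)` is controllable exactly for those indices `i` satisfying condition (2). -/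
theorem single_leader_controllability {n : ℕ} (hn : 0 < n)
    (w : Matrix (Fin n) (Fin n) ℝ)
    (hw_noloop : ∀ i, w i i = 0) (hw_nonneg : ∀ i j, 0 ≤ w i j)
    (L : Matrix (Fin n) (Fin n) ℝ)
    (hL : ∀ i j, L i j = if i = j then ∑ k, w i k else -w i j)
    (P J : Matrix (Fin n) (Fin n) ℂ) (d t : Fin n → ℂ)
    (hP : IsUnit P.det)
    (hJ : ∀ i j, J i j = if j = i then d i else if (j : ℕ) = (i : ℕ) + 1 then t i else 0)
    (ht01 : ∀ i, t i = 0 ∨ t i = 1)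
    (hblk : ∀ i j : Fin n, (j : ℕ) = (i : ℕ) + 1 → t i = 1 → d j = d i)
    (hdecomp : P⁻¹ * (L.map (fun x : ℝ => (x : ℂ))) * P = J) :
    ((∃ i : Fin n, (ctrbMat L (Pi.single i 1)).rank = n) ↔
      (L.charpoly = minpoly ℝ L ∧
        ∃ i : Fin n, ∀ m : Fin n, ((m : ℕ) = n - 1 ∨ t m = 0) → P⁻¹ m i ≠ 0)) ∧
    ((L.charpoly = minpoly ℝ L ∧
        ∃ i : Fin n, ∀ m : Fin n, ((m : ℕ) = n - 1 ∨ t m = 0) → P⁻¹ m i ≠ 0) →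
      ∀ i : Fin n, ((ctrbMat L (Pi.single i 1)).rank = n ↔
        ∀ m : Fin n, ((m : ℕ) = n - 1 ∨ t m = 0) → P⁻¹ m i ≠ 0)) := by
  have key := ctrbMat_single_rank_eq_iff hP hJ ht01 hblk hdecomp
  simp only [key]
  exact ⟨exists_and_left, fun h i => and_iff_right h.1⟩
end

section
/- Let L ∈ ℝ^{n×n} be the Laplacian of a weighted directed graph on n vertices, suppose L is cyclic, and fix a Jordan decomposition P^{−1} L P = J = diag(J_0, …, J_s) with last-row indices m_0, …, m_s. Then for each agent i ∈ {1,…,n}, the pair (L, e_i) is controllable (agent i can be selected as the single leader to control the system) if and only if the i-th column η^i of P^{−1} satisfies η^i_{m_j} ≠ 0 for every j = 0, 1, …, s. -/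
open Matrix

section JordanForm

variable {K : Type*} [Field K] {n : ℕ}

/-- The bidiagonal matrix with diagonal `d` and superdiagonal `t`. -/
def bidiag (d t : Fin n → K) : Matrix (Fin n) (Fin n) K :=
  Matrix.of fun i j => if j = i then d i else if (j : ℕ) = (i : ℕ) + 1 then t i else 0

/-- `m` is the last row of a block: `t` vanishes there, or it is the last row overall. -/
def IsBlockLast (t : Fin n → K) (m : Fin n) : Prop := (m : ℕ) = n - 1 ∨ t m = 0

theorem single_vecMul_bidiag_of_isBlockLast {d t : Fin n → K} {m : Fin n}
    (hm : IsBlockLast t m) :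
    Pi.single m 1 ᵥ* bidiag d t = d m • Pi.single m (1 : K) := by
  ext j
  rw [single_one_vecMul]
  by_cases hj : j = m
  · subst hj; simp [bidiag]
  · rcases hm with hm | hm
    · have : (j : ℕ) ≠ m + 1 := by omega
      simp [bidiag, hj, this]
    · simp [bidiag, hj, hm]

theorem single_vecMul_bidiag_of_succ {d t : Fin n → K} {i j : Fin n} (hij : (j : ℕ) = i + 1) :
    Pi.single i 1 ᵥ* bidiag d t = d i • Pi.single i (1 : K) + t i • Pi.single j 1 := by
  have hne : j ≠ i := by rintro rfl; omega
  ext k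
  rw [single_one_vecMul]
  by_cases hk : k = i
  · subst hk; simp [bidiag, hne.symm]
  · by_cases hkj : k = j
    · subst hkj; simp [bidiag, hne, hij]
    · have : (k : ℕ) ≠ i + 1 := fun h => hkj (Fin.ext (h.trans hij.symm))
      simp [bidiag, hk, hkj, this]

theorem vecMul_bidiag_apply_of_succ {d t : Fin n → K} {i j : Fin n} (hij : (j : ℕ) = i + 1)
    (u : Fin n → K) : (u ᵥ* bidiag d t) j = u j * d j + u i * t i := by
  have hne : j ≠ i := by rintro rfl; omega
  rw [vecMul, dotProduct, Finset.sum_eq_add j i hne]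
  · simp [bidiag, hne, hij]
  · intro k _ hk
    have : (j : ℕ) ≠ k + 1 := fun h => hk.2 (Fin.ext (by omega))
    simp [bidiag, hk.1.symm, this]
  · simp
  · simp

theorem vecMul_bidiag_apply_zero {d t : Fin n → K} {j : Fin n} (hj : (j : ℕ) = 0)
    (u : Fin n → K) : (u ᵥ* bidiag d t) j = u j * d j := by
  rw [vecMul, dotProduct, Finset.sum_eq_single j]
  · simp [bidiag]
  · intro k _ hk
    have : (j : ℕ) ≠ k + 1 := by omega
    simp [bidiag, hk.symm, this]
  · simp

/-- A left eigenvector of a Jordan matrix is supported on the last rows of the blocks with that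
eigenvalue. -/
theorem isBlockLast_of_left_eigenvector {d t : Fin n → K} (ht01 : ∀ i, t i = 0 ∨ t i = 1)
    (hblk : ∀ i j : Fin n, (j : ℕ) = (i : ℕ) + 1 → t i = 1 → d j = d i)
    {u : Fin n → K} {μ : K} (hu : u ᵥ* bidiag d t = μ • u) :
    ∀ j : Fin n, u j ≠ 0 → IsBlockLast t j ∧ d j = μ := by
  have last_of : ∀ j : Fin n, u j ≠ 0 → d j = μ → IsBlockLast t j := by
    intro j hne hd
    by_contra hlast
    rw [IsBlockLast, not_or] at hlast
    have hlt : (j : ℕ) + 1 < n := by omega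
    have ht : t j = 1 := (ht01 j).resolve_left hlast.2
    have h := congrFun hu ⟨j + 1, hlt⟩
    rw [vecMul_bidiag_apply_of_succ (i := j) rfl, Pi.smul_apply, smul_eq_mul,
      hblk j ⟨j + 1, hlt⟩ rfl ht, hd, ht, mul_comm μ] at h
    exact hne (by simpa using h)
  have key : ∀ (k : ℕ) (j : Fin n), (j : ℕ) = k → u j ≠ 0 → IsBlockLast t j ∧ d j = μ := by
    intro k
    induction k with
    | zero =>
      intro j hj hne
      have hd : d j = μ := by
        have h := congrFun hu j
        rw [vecMul_bidiag_apply_zero hj, Pi.smul_apply, smul_eq_mul, mul_comm] at h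
        exact mul_right_cancel₀ hne h
      exact ⟨last_of j hne hd, hd⟩
    | succ k ih =>
      intro j hj hne
      have hi : k < n := by omega
      have h := congrFun hu j
      rw [vecMul_bidiag_apply_of_succ (i := ⟨k, hi⟩) hj, Pi.smul_apply, smul_eq_mul] at h
      have h0 : u ⟨k, hi⟩ * t ⟨k, hi⟩ = 0 := by
        by_contra hc
        rcases (ih ⟨k, hi⟩ rfl (left_ne_zero_of_mul hc)).1 with h1 | h1
        · simp only at h1; omega
        · exact hc (by rw [h1, mul_zero])
      have hd : d j = μ := by
        rw [h0, add_zero, mul_comm] at h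
        exact mul_right_cancel₀ hne h
      exact ⟨last_of j hne hd, hd⟩
  exact fun j => key j j rfl

open Polynomial in
/-- Row `j` of `∏_{k ∈ S} (J - d k)` vanishes once `S` contains an interval from `j` to the last
row of a block. -/
theorem single_vecMul_aeval_prod_eq_zero {d t : Fin n → K} {l : Fin n} (hl : IsBlockLast t l) :
    ∀ (r : ℕ) (j : Fin n) (S : Finset (Fin n)), (j : ℕ) + r = l →
      (∀ k, j ≤ k → k ≤ l → k ∈ S) →
      Pi.single j (1 : K) ᵥ* aeval (bidiag d t) (∏ k ∈ S, (X - C (d k))) = 0 := by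
  have single_eq_smul : ∀ j : Fin n, Pi.single j (d j) = d j • Pi.single j (1 : K) := fun j => by
    rw [← Pi.single_smul, smul_eq_mul, mul_one]
  intro r
  induction r with
  | zero =>
    intro j S hjl hS
    obtain rfl : j = l := Fin.ext hjl
    rw [← Finset.mul_prod_erase S _ (hS j le_rfl le_rfl), map_mul, ← vecMul_vecMul]
    simp [vecMul_sub, single_vecMul_bidiag_of_isBlockLast hl, algebraMap_eq_diagonal,
      single_eq_smul]
  | succ r ih =>
    intro j S hjl hS
    have hlt : (j : ℕ) + 1 < n := by omega
    have hjS : j ∈ S := hS j le_rfl (Fin.le_def.2 (by omega))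
    rw [← Finset.mul_prod_erase S _ hjS, map_mul, ← vecMul_vecMul]
    have hstep : Pi.single j (1 : K) ᵥ* aeval (bidiag d t) (X - C (d j)) =
        t j • Pi.single ⟨j + 1, hlt⟩ 1 := by
      simp [vecMul_sub, single_vecMul_bidiag_of_succ (i := j) (j := ⟨j + 1, hlt⟩) rfl,
        algebraMap_eq_diagonal, single_eq_smul]
    rw [hstep, smul_vecMul, ih ⟨j + 1, hlt⟩ (S.erase j) (by simp only; omega), smul_zero]
    intro k hk hkl
    have hk' : (j : ℕ) + 1 ≤ k := hk
    refine Finset.mem_erase.2 ⟨?_, hS k (Fin.le_def.2 (by omega)) hkl⟩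
    rintro rfl
    omega

open Polynomial in
/-- If two blocks of a Jordan matrix share an eigenvalue, then the matrix is annihilated by a monic
polynomial of degree `n - 1`. -/
theorem exists_monic_aeval_bidiag_eq_zero {d t : Fin n → K} {m m' : Fin n} (hlt : m < m')
    (hm : IsBlockLast t m) (hd : d m = d m') :
    ∃ q : K[X], q.Monic ∧ q.natDegree < n ∧ aeval (bidiag d t) q = 0 := by
  refine ⟨∏ k ∈ Finset.univ.erase m, (X - C (d k)), monic_prod_X_sub_C _ _, ?_, ?_⟩
  · rw [natDegree_finsetProd_X_sub_C_eq_card, Finset.card_erase_of_mem (Finset.mem_univ _)]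
    simp only [Finset.card_univ, Fintype.card_fin]
    omega
  · have hswap : ∏ k ∈ Finset.univ.erase m, (X - C (d k)) =
        ∏ k ∈ Finset.univ.erase m', (X - C (d k)) := by
      apply mul_left_cancel₀ (X_sub_C_ne_zero (d m))
      rw [Finset.mul_prod_erase _ (fun k => X - C (d k)) (Finset.mem_univ m), hd,
        Finset.mul_prod_erase _ (fun k => X - C (d k)) (Finset.mem_univ m')]
    refine Matrix.ext fun j k => ?_
    suffices h : Pi.single j (1 : K) ᵥ* aeval (bidiag d t)
        (∏ k ∈ Finset.univ.erase m, (X - C (d k))) = 0 by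
      rw [single_one_vecMul] at h
      exact congrFun h k
    rcases lt_or_ge m j with hj | hj
    · refine single_vecMul_aeval_prod_eq_zero (l := ⟨n - 1, by omega⟩) (Or.inl rfl)
        (n - 1 - j) j _ (by simp only; omega) fun k hk _ => ?_
      exact Finset.mem_erase.2 ⟨(hj.trans_le hk).ne', Finset.mem_univ _⟩
    · rw [hswap]
      refine single_vecMul_aeval_prod_eq_zero hm (m - j) j _
        (by have := Fin.le_def.1 hj; omega) fun k _ hk => ?_
      exact Finset.mem_erase.2 ⟨(hk.trans_lt hlt).ne, Finset.mem_univ _⟩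

end JordanForm

open Polynomial in
/-- No monic complex polynomial of degree less than that of the minimal polynomial of a real matrix
annihilates its complexification. -/
theorem aeval_map_ofReal_ne_zero {ι : Type*} [Fintype ι] [DecidableEq ι] (L : Matrix ι ι ℝ)
    {q : ℂ[X]} (hq : q.Monic) (hdeg : q.natDegree < (minpoly ℝ L).natDegree) :
    aeval (L.map (fun x : ℝ => (x : ℂ))) q ≠ 0 := by
  intro h0
  set a : ℝ[X] := ∑ k ∈ Finset.range (q.natDegree + 1), monomial k (q.coeff k).re with ha
  have hcoeff : a.coeff q.natDegree = 1 := by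
    simp [ha, finsetSum_coeff, coeff_monomial, hq.coeff_natDegree]
  have ha0 : a ≠ 0 := by
    intro h
    simp [h] at hcoeff
  have hadeg : a.natDegree ≤ q.natDegree := by
    refine natDegree_sum_le_of_forall_le _ _ fun k hk => (natDegree_monomial_le _).trans ?_
    exact Nat.lt_succ_iff.1 (Finset.mem_range.1 hk)
  have haL : aeval L a = 0 := by
    ext i j
    have hpow : ∀ k : ℕ, L.map (fun x : ℝ => (x : ℂ)) ^ k = (L ^ k).map fun x : ℝ => (x : ℂ) :=
      fun k => (map_pow Complex.ofRealHom.mapMatrix L k).symm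
    have h := congrArg Complex.re (congrFun (congrFun h0 i) j)
    simp only [aeval_eq_sum_range, hpow, Matrix.sum_apply, Matrix.smul_apply, map_apply, smul_eq_mul,
      Complex.re_sum, Complex.re_mul_ofReal, Matrix.zero_apply, Complex.zero_re] at h
    simpa [ha, aeval_monomial, Matrix.sum_apply, ← Algebra.smul_def] using h
  have := natDegree_le_natDegree (minpoly.degree_le_of_ne_zero ℝ L ha0 haL)
  omega

open Polynomial in
/-- By Cayley–Hamilton, a vector orthogonal to `b, Lb, …, L^{n-1}b` is orthogonal to every
`L^k b`. -/
theorem dotProduct_pow_mulVec_eq_zero {R : Type*} [CommRing R] [Nontrivial R] {n : ℕ}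
    (L : Matrix (Fin n) (Fin n) R) (v b : Fin n → R)
    (h : ∀ k < n, v ⬝ᵥ (L ^ k *ᵥ b) = 0) (k : ℕ) : v ⬝ᵥ (L ^ k *ᵥ b) = 0 := by
  rcases Nat.eq_zero_or_pos n with rfl | hn
  · simp [dotProduct]
  rw [Matrix.pow_eq_aeval_mod_charpoly, aeval_eq_sum_range, sum_mulVec, dotProduct_sum]
  refine Finset.sum_eq_zero fun j hj => ?_
  have hlt : (X ^ k %ₘ L.charpoly).natDegree < n := by
    have h1 := natDegree_modByMonic_lt (X ^ k) L.charpoly_monic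
      (fun h1 => by
        have := L.charpoly_natDegree_eq_dim
        simp [h1] at this; omega)
    rwa [L.charpoly_natDegree_eq_dim, Fintype.card_fin] at h1
  rw [smul_mulVec, dotProduct_smul, h j (by have := Finset.mem_range.1 hj; omega), smul_zero]

/-- A nonzero vector orthogonal to every `A^k b` can be replaced by a left eigenvector of `A`
orthogonal to `b`. -/
theorem exists_left_eigenvector_dotProduct_eq_zero {K : Type*} [Field K] [IsAlgClosed K]
    {ι : Type*} [Fintype ι] [DecidableEq ι] (A : Matrix ι ι K) (b v : ι → K) (hv : v ≠ 0)
    (h : ∀ k : ℕ, v ⬝ᵥ (A ^ k *ᵥ b) = 0) :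
    ∃ (u : ι → K) (μ : K), u ≠ 0 ∧ u ᵥ* A = μ • u ∧ u ⬝ᵥ b = 0 := by
  let W : Submodule K (ι → K) :=
    { carrier := {u | ∀ k : ℕ, u ⬝ᵥ (A ^ k *ᵥ b) = 0}
      add_mem' := fun hx hy k => by rw [add_dotProduct, hx k, hy k, add_zero]
      zero_mem' := fun k => zero_dotProduct _
      smul_mem' := fun c x hx k => by rw [smul_dotProduct, hx k, smul_zero] }
  have hinv : ∀ u ∈ W, A.vecMulLinear u ∈ W := fun u hu k => by
    rw [vecMulLinear_apply, ← dotProduct_mulVec, mulVec_mulVec, ← pow_succ']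
    exact hu (k + 1)
  have : Nontrivial W := ⟨⟨⟨v, h⟩, 0, fun h0 => hv (congrArg Subtype.val h0)⟩⟩
  obtain ⟨μ, hμ⟩ := Module.End.exists_eigenvalue (A.vecMulLinear.restrict hinv)
  obtain ⟨u, hu⟩ := hμ.exists_hasEigenvector
  refine ⟨u, μ, fun h0 => hu.2 (Subtype.ext h0), congrArg Subtype.val hu.apply_eq_smul, ?_⟩
  simpa using u.2 0

theorem rank_eq_card_iff_det_ne_zero {K ι : Type*} [Field K] [Fintype ι] [DecidableEq ι]
    (M : Matrix ι ι K) : M.rank = Fintype.card ι ↔ M.det ≠ 0 := by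
  constructor
  · intro h
    have hli : LinearIndependent K M.row := by
      rw [linearIndependent_iff_card_eq_finrank_span, ← h, rank_eq_finrank_span_row]
      rfl
    exact ((isUnit_iff_isUnit_det M).1 (linearIndependent_rows_iff_isUnit.1 hli)).ne_zero
  · intro h
    exact rank_of_isUnit M ((isUnit_iff_isUnit_det M).2 (isUnit_iff_ne_zero.2 h))

/-- The controllability matrix of a real pair is singular iff some nonzero complex vector is
orthogonal to every `L^k b`. -/
theorem rank_ctrbMat_ne_iff {n : ℕ} (L : Matrix (Fin n) (Fin n) ℝ) (b : Fin n → ℝ) :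
    (ctrbMat L b).rank ≠ n ↔ ∃ v : Fin n → ℂ, v ≠ 0 ∧
      ∀ k : ℕ, v ⬝ᵥ (L.map (fun x : ℝ => (x : ℂ)) ^ k *ᵥ fun j => (b j : ℂ)) = 0 := by
  have hdet : (ctrbMat L b).rank ≠ n ↔ ((ctrbMat L b).map fun x : ℝ => (x : ℂ)).det = 0 := by
    have h1 := rank_eq_card_iff_det_ne_zero (ctrbMat L b)
    rw [Fintype.card_fin] at h1
    rw [Ne, h1, not_not]
    have h2 := RingHom.map_det Complex.ofRealHom (ctrbMat L b)
    change ((ctrbMat L b).det : ℂ) = ((ctrbMat L b).map fun x : ℝ => (x : ℂ)).det at h2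
    rw [← h2, Complex.ofReal_eq_zero]
  have hcol : ∀ (v : Fin n → ℂ) (k : Fin n),
      (v ᵥ* (ctrbMat L b).map fun x : ℝ => (x : ℂ)) k =
        v ⬝ᵥ (L.map (fun x : ℝ => (x : ℂ)) ^ (k : ℕ) *ᵥ fun j => (b j : ℂ)) := by
    intro v k
    have hpow : L.map (fun x : ℝ => (x : ℂ)) ^ (k : ℕ) = (L ^ (k : ℕ)).map fun x : ℝ => (x : ℂ) :=
      (map_pow Complex.ofRealHom.mapMatrix L k).symm
    rw [hpow]
    simp [vecMul, dotProduct, mulVec, ctrbMat]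
  rw [hdet, ← exists_vecMul_eq_zero_iff]
  refine exists_congr fun v => and_congr_right fun _ => ⟨fun h => ?_, fun h => ?_⟩
  · refine dotProduct_pow_mulVec_eq_zero _ v _ fun k hk => ?_
    rw [← hcol v ⟨k, hk⟩, h, Pi.zero_apply]
  · ext k
    rw [hcol, h, Pi.zero_apply]

open Polynomial in
theorem mul_aeval_eq_aeval_mul {R A : Type*} [CommSemiring R] [Semiring A] [Algebra R A]
    {p a b : A} (h : b * p = p * a) (q : R[X]) : aeval b q * p = p * aeval a q := by
  induction q using Polynomial.induction_on' with
  | add q r hq hr => rw [map_add, map_add, add_mul, mul_add, hq, hr]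
  | monomial k c =>
    have hk : b ^ k * p = p * a ^ k := (SemiconjBy.pow_right (x := a) (y := b) h.symm k).symm
    rw [aeval_monomial, aeval_monomial, mul_assoc, hk, ← mul_assoc, Algebra.commutes, mul_assoc]

/-- Let `L` be the Laplacian of a weighted directed graph on `n` vertices, suppose `L` is
cyclic (its characteristic polynomial equals its minimal polynomial), and fix a Jordan
decomposition `P⁻¹ L P = J`, where `J` is encoded by its diagonal `d` and superdiagonal `t`
(`t i ∈ {0,1}`, and `t i = 1` forces equal neighbouring diagonal entries; the last rows of
the Jordan blocks are the indices `m` with `(m : ℕ) = n - 1` or `t m = 0`).  Then for each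
agent `i`, the pair `(L, e_i)` is controllable iff the `i`-th column of `P⁻¹` has nonzero
entries at all block-last rows. -/
theorem agent_single_leader_iff {n : ℕ} (hn : 0 < n)
    (w : Matrix (Fin n) (Fin n) ℝ)
    (hw_noloop : ∀ i, w i i = 0) (hw_nonneg : ∀ i j, 0 ≤ w i j)
    (L : Matrix (Fin n) (Fin n) ℝ)
    (hL : ∀ i j, L i j = if i = j then ∑ k, w i k else -w i j)
    (hcyclic : L.charpoly = minpoly ℝ L)
    (P J : Matrix (Fin n) (Fin n) ℂ) (d t : Fin n → ℂ)
    (hP : IsUnit P.det)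
    (hJ : ∀ i j, J i j = if j = i then d i else if (j : ℕ) = (i : ℕ) + 1 then t i else 0)
    (ht01 : ∀ i, t i = 0 ∨ t i = 1)
    (hblk : ∀ i j : Fin n, (j : ℕ) = (i : ℕ) + 1 → t i = 1 → d j = d i)
    (hdecomp : P⁻¹ * (L.map (fun x : ℝ => (x : ℂ))) * P = J) :
    ∀ i : Fin n, ((ctrbMat L (Pi.single i 1)).rank = n ↔
      ∀ m : Fin n, ((m : ℕ) = n - 1 ∨ t m = 0) → P⁻¹ m i ≠ 0) := by
  intro i
  obtain rfl : J = bidiag d t := Matrix.ext hJ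
  set A := L.map (fun x : ℝ => (x : ℂ)) with hA
  have hPA : P⁻¹ * A = bidiag d t * P⁻¹ := by
    rw [← hdecomp, mul_nonsing_inv_cancel_right _ _ hP]
  have hAP : A * P = P * bidiag d t := by
    rw [← hdecomp, mul_assoc, mul_nonsing_inv_cancel_left _ _ hP]
  have hb : (fun j => ((Pi.single i 1 : Fin n → ℝ) j : ℂ)) = Pi.single i 1 := by
    ext j
    by_cases hj : j = i
    · subst hj; simp
    · simp [hj]
  have hrank := rank_ctrbMat_ne_iff L (Pi.single i 1)
  rw [hb, ← hA] at hrank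
  constructor
  · intro h m hm hz
    refine hrank.2 ⟨Pi.single m 1 ᵥ* P⁻¹, ?_, fun k => ?_⟩ h
    · intro h0
      have h1 := congrArg (· ᵥ* P) h0
      simp only [vecMul_vecMul, nonsing_inv_mul _ hP, vecMul_one, zero_vecMul] at h1
      simpa using congrFun h1 m
    · have hk : Pi.single m 1 ᵥ* P⁻¹ ᵥ* A ^ k = d m ^ k • (Pi.single m (1 : ℂ) ᵥ* P⁻¹) := by
        induction k with
        | zero => simp
        | succ k ih =>
          rw [pow_succ, ← vecMul_vecMul, ih, smul_vecMul, vecMul_vecMul, hPA, ← vecMul_vecMul,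
            single_vecMul_bidiag_of_isBlockLast hm, smul_vecMul, smul_smul, pow_succ]
      rw [dotProduct_mulVec, hk, smul_dotProduct, single_one_vecMul, dotProduct_single_one,
        row_apply, hz, smul_zero]
  · intro h
    by_contra hc
    obtain ⟨v, hv, hvk⟩ := hrank.1 hc
    obtain ⟨x, μ, hx, hxA, hxi⟩ := exists_left_eigenvector_dotProduct_eq_zero A _ v hv hvk
    have huJ : (x ᵥ* P) ᵥ* bidiag d t = μ • (x ᵥ* P) := by
      rw [vecMul_vecMul, ← hAP, ← vecMul_vecMul, hxA, smul_vecMul]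
    have hsupp := isBlockLast_of_left_eigenvector ht01 hblk huJ
    have hux : (x ᵥ* P) ᵥ* P⁻¹ = x := by
      rw [vecMul_vecMul, mul_nonsing_inv _ hP, vecMul_one]
    have hsimple : ∀ m m' : Fin n, m < m' → IsBlockLast t m → d m ≠ d m' := by
      intro m m' hlt hm hd
      obtain ⟨q, hq, hdeg, hqJ⟩ := exists_monic_aeval_bidiag_eq_zero hlt hm hd
      refine aeval_map_ofReal_ne_zero L hq ?_ ?_
      · rwa [← hcyclic, L.charpoly_natDegree_eq_dim, Fintype.card_fin]
      · rw [← hA, ← mul_nonsing_inv_cancel_right (A := P) (Polynomial.aeval A q) hP,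
          mul_aeval_eq_aeval_mul hAP, hqJ, mul_zero, zero_mul]
    obtain ⟨m, hm⟩ : ∃ m, (x ᵥ* P) m ≠ 0 := by
      by_contra! h0
      exact hx (by rw [← hux, funext h0]; exact zero_vecMul _)
    have huniq : ∀ j, j ≠ m → (x ᵥ* P) j = 0 := by
      intro j hj
      by_contra hne
      have hd : d j = d m := (hsupp j hne).2.trans (hsupp m hm).2.symm
      rcases lt_or_gt_of_ne hj with hlt | hlt
      · exact hsimple j m hlt (hsupp j hne).1 hd
      · exact hsimple m j hlt (hsupp m hm).1 hd.symm
    have hxi' : (x ᵥ* P) m * P⁻¹ m i = 0 := by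
      rw [dotProduct_single_one, ← hux, vecMul, dotProduct, Finset.sum_eq_single m] at hxi
      · exact hxi
      · intro j _ hj
        rw [huniq j hj, zero_mul]
      · simp
    exact (mul_ne_zero hm (h m (hsupp m hm).1)) hxi'
end

section
/- Let L ∈ ℝ^{n×n} be the Laplacian of a weighted directed graph G on n vertices and let v be a vertex. If the pair (L, e_v) is controllable, then G contains a spanning tree rooted at v, i.e. every vertex of G is reachable from v. -/
open Matrix

/-- If no nonzero entry of `A` leads from outside `s` into `s`, and `x` vanishes on `s`, then so
does `A ^ k *ᵥ x` for every `k`. -/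
theorem pow_mulVec_eq_zero_of_mem {ι R : Type*} [Fintype ι] [DecidableEq ι] [Semiring R]
    {A : Matrix ι ι R} {s : Set ι} (hA : ∀ i ∈ s, ∀ j ∉ s, A i j = 0)
    {x : ι → R} (hx : ∀ i ∈ s, x i = 0) (k : ℕ) : ∀ i ∈ s, (A ^ k *ᵥ x) i = 0 := by
  induction k with
  | zero => simpa using hx
  | succ k ih =>
    intro i hi
    rw [pow_succ', ← mulVec_mulVec]
    refine Finset.sum_eq_zero fun j _ => ?_
    by_cases hj : j ∈ s
    · rw [ih j hj, mul_zero]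
    · exact mul_eq_zero_of_left (hA i hi j hj) _

/-- Let `L` be the Laplacian of a weighted directed graph `G` on `n` vertices (the weight of
the edge `j → i` is `w i j`, which is `0` iff the edge is absent; no self-loops), and let
`v` be a vertex.  If the pair `(L, e_v)` is controllable, then `G` contains a spanning tree
rooted at `v`, i.e. every vertex is reachable from `v` along directed edges
(`a → b` is an edge iff `0 < w b a`). -/
theorem controllable_imp_spanning_tree {n : ℕ}
    (w : Matrix (Fin n) (Fin n) ℝ)
    (hw_noloop : ∀ i, w i i = 0) (hw_nonneg : ∀ i j, 0 ≤ w i j)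
    (L : Matrix (Fin n) (Fin n) ℝ)
    (hL : ∀ i j, L i j = if i = j then ∑ k, w i k else -w i j)
    (v : Fin n)
    (hctrb : (ctrbMat L (Pi.single v 1)).rank = n) :
    ∀ u : Fin n, Relation.ReflTransGen (fun a b => 0 < w b a) v u := by
  intro u
  by_contra hu
  have hrow : (ctrbMat L (Pi.single v 1)).row u = 0 := by
    funext k
    refine pow_mulVec_eq_zero_of_mem
      (s := {i | ¬ Relation.ReflTransGen (fun a b => 0 < w b a) v i}) ?_ ?_ k u hu
    · intro i hi j hj
      have hvj : Relation.ReflTransGen (fun a b => 0 < w b a) v j := not_not.mp hj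
      have hij : i ≠ j := by
        rintro rfl
        exact hi hvj
      rw [hL, if_neg hij, neg_eq_zero]
      by_contra hw
      exact hi (hvj.tail ((hw_nonneg i j).lt_of_ne' hw))
    · intro i hi
      refine Pi.single_eq_of_ne ?_ _
      rintro rfl
      exact hi .refl
  have hli : LinearIndependent ℝ (ctrbMat L (Pi.single v 1)).row := by
    rw [linearIndependent_iff_card_eq_finrank_span, Fintype.card_fin, Set.finrank,
      ← rank_eq_finrank_span_row, hctrb]
  exact hli.ne_zero u hrow
end

section
/- Let L ∈ ℝ^{n×n} be the Laplacian of a weighted directed graph, with distinct complex eigenvalues λ_0, λ_1, …, λ_t of geometric multiplicities k_0, k_1, …, k_t respectively (k_i = dim_ℂ ker(L − λ_i I)), and set k = max{k_0, k_1, …, k_t}. Let r be the minimum cardinality of a set S ⊆ {1,…,n} such that the pair (L, B_S) is controllable, where B_S is the matrix whose columns are the standard basis vectors e_i for i ∈ S (such a set exists, since S = {1,…,n} gives B_S = I which is controllable). Then k ≤ r ≤ k_0 + k_1 + ⋯ + k_t. -/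
open Matrix
open scoped Classical

/-- The controllability matrix of the pair `(L, B_S)` where the columns of `B_S` are the
standard basis vectors `e_i`, `i ∈ S`. -/
noncomputable def ctrbMatSet {n : ℕ} (L : Matrix (Fin n) (Fin n) ℝ) (S : Finset (Fin n)) :
    Matrix (Fin n) (Fin n × {x // x ∈ S}) ℝ :=
  Matrix.of fun i p => ((L ^ (p.1 : ℕ)).mulVec (Pi.single (p.2 : Fin n) 1)) i

/-- The geometric multiplicity of `μ ∈ ℂ` as an eigenvalue of the (complexified)
matrix `Lc`, i.e. `dim_ℂ ker (Lc − μ I)`. -/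
noncomputable def geomMult {n : ℕ} (Lc : Matrix (Fin n) (Fin n) ℂ) (μ : ℂ) : ℕ :=
  Module.finrank ℂ (LinearMap.ker (Matrix.mulVecLin (Lc - μ • (1 : Matrix (Fin n) (Fin n) ℂ))))

/-- The left eigenspace of `M` for `μ` has the same dimension as the right eigenspace. -/
lemma finrank_ker_transpose_eq_geomMult {n : ℕ} (M : Matrix (Fin n) (Fin n) ℂ) (μ : ℂ) :
    Module.finrank ℂ (LinearMap.ker (Matrix.mulVecLin (M - μ • (1 : Matrix (Fin n) (Fin n) ℂ))ᵀ)) =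
      geomMult M μ := by
  have h₁ := LinearMap.finrank_range_add_finrank_ker
    (Matrix.mulVecLin (M - μ • (1 : Matrix (Fin n) (Fin n) ℂ)))
  have h₂ := LinearMap.finrank_range_add_finrank_ker
    (Matrix.mulVecLin (M - μ • (1 : Matrix (Fin n) (Fin n) ℂ))ᵀ)
  have h₃ := Matrix.rank_transpose (M - μ • (1 : Matrix (Fin n) (Fin n) ℂ))
  unfold Matrix.rank at h₃
  unfold geomMult
  omega

lemma mem_ker_transpose_sub_iff {n : ℕ} (M : Matrix (Fin n) (Fin n) ℂ) (μ : ℂ) (v : Fin n → ℂ) :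
    v ∈ LinearMap.ker (Matrix.mulVecLin (M - μ • (1 : Matrix (Fin n) (Fin n) ℂ))ᵀ) ↔
      v ᵥ* M = μ • v := by
  rw [LinearMap.mem_ker, Matrix.mulVecLin_apply, Matrix.mulVec_transpose, Matrix.vecMul_sub,
    Matrix.vecMul_smul, Matrix.vecMul_one, sub_eq_zero]

lemma isRoot_charpoly_of_vecMul_eq_smul {n : ℕ} {M : Matrix (Fin n) (Fin n) ℂ} {μ : ℂ}
    {v : Fin n → ℂ} (hv : v ≠ 0) (h : v ᵥ* M = μ • v) : M.charpoly.IsRoot μ := by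
  rw [Polynomial.IsRoot, Matrix.eval_charpoly, ← Matrix.exists_vecMul_eq_zero_iff]
  refine ⟨v, hv, ?_⟩
  rw [Matrix.vecMul_sub, h, Matrix.scalar_apply, ← Matrix.smul_one_eq_diagonal,
    Matrix.vecMul_smul, Matrix.vecMul_one, sub_self]

lemma vecMul_pow_of_vecMul_eq_smul {n : ℕ} {M : Matrix (Fin n) (Fin n) ℂ} {μ : ℂ}
    {v : Fin n → ℂ} (h : v ᵥ* M = μ • v) (k : ℕ) : v ᵥ* M ^ k = μ ^ k • v := by
  induction k with
  | zero => simp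
  | succ k ih =>
    rw [pow_succ, ← Matrix.vecMul_vecMul, ih, Matrix.smul_vecMul, h, smul_smul, pow_succ]

/-- A subspace of `K ^ ι` is separated from zero by at most `dim W` coordinates. -/
lemma Submodule.exists_finset_card_le_finrank_forall_eq_zero {K ι : Type*} [Field K] [Fintype ι]
    (W : Submodule K (ι → K)) :
    ∃ S : Finset ι, S.card ≤ Module.finrank K W ∧ ∀ v ∈ W, (∀ s ∈ S, v s = 0) → v = 0 := by
  induction hd : Module.finrank K W using Nat.strong_induction_on generalizing W with
  | _ d ih =>
    by_cases hW : ∀ v ∈ W, v = 0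
    · exact ⟨∅, by simp, fun v hv _ => hW v hv⟩
    · push Not at hW
      obtain ⟨v, hv, hv0⟩ := hW
      obtain ⟨i, hi⟩ := Function.ne_iff.mp hv0
      have hlt : W ⊓ LinearMap.ker (LinearMap.proj i : (ι → K) →ₗ[K] K) < W := by
        refine lt_of_le_of_ne inf_le_left fun h => hi ?_
        rw [← h] at hv
        simpa using hv.2
      have hfin := Submodule.finrank_lt_finrank_of_lt hlt
      obtain ⟨S, hS, hS'⟩ := ih _ (hd ▸ hfin) _ rfl
      refine ⟨insert i S, (Finset.card_insert_le _ _).trans (by omega), fun u hu h => ?_⟩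
      exact hS' u ⟨hu, by simpa using h i (Finset.mem_insert_self _ _)⟩
        fun s hs => h s (Finset.mem_insert_of_mem hs)

lemma Matrix.rank_eq_card_iff_forall_vecMul_eq_zero {n : ℕ} {m : Type*} [Fintype m]
    {K : Type*} [Field K] (A : Matrix (Fin n) m K) :
    A.rank = n ↔ ∀ v : Fin n → K, v ᵥ* A = 0 → v = 0 := by
  have h := LinearMap.finrank_range_add_finrank_ker Aᵀ.mulVecLin
  have h₃ := Matrix.rank_transpose A
  rw [Module.finrank_fin_fun] at h
  have h₄ : A.rank = n ↔ Module.finrank K (LinearMap.ker Aᵀ.mulVecLin) = 0 := by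
    rw [← h₃]
    unfold Matrix.rank
    omega
  rw [h₄, Submodule.finrank_eq_zero, LinearMap.ker_eq_bot']
  simp only [Matrix.mulVecLin_apply, Matrix.mulVec_transpose]

lemma forall_vecMul_map_ofReal_iff {n : ℕ} {m : Type*} (A : Matrix (Fin n) m ℝ) :
    (∀ v : Fin n → ℝ, v ᵥ* A = 0 → v = 0) ↔
      ∀ v : Fin n → ℂ, v ᵥ* A.map (fun x : ℝ => (x : ℂ)) = 0 → v = 0 := by
  constructor
  · intro h v hv
    have hre : (fun i => (v i).re) = 0 := h _ <| by
      ext j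
      simpa [Matrix.vecMul, dotProduct] using congrArg Complex.re (congrFun hv j)
    have him : (fun i => (v i).im) = 0 := h _ <| by
      ext j
      simpa [Matrix.vecMul, dotProduct] using congrArg Complex.im (congrFun hv j)
    ext i
    exact Complex.ext (congrFun hre i) (congrFun him i)
  · intro h v hv
    have := h (fun i => (v i : ℂ)) <| by
      ext j
      have hj := congrArg (fun x : ℝ => (x : ℂ)) (congrFun hv j)
      simpa [Matrix.vecMul, dotProduct] using hj
    ext i
    simpa using congrFun this i

lemma vecMul_ctrbMatSet_map_eq_zero_iff {n : ℕ} (L : Matrix (Fin n) (Fin n) ℝ)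
    (S : Finset (Fin n)) (v : Fin n → ℂ) :
    v ᵥ* (ctrbMatSet L S).map (fun x : ℝ => (x : ℂ)) = 0 ↔
      ∀ k < n, ∀ s ∈ S, (v ᵥ* L.map (fun x : ℝ => (x : ℂ)) ^ k) s = 0 := by
  have hpow (k : ℕ) : L.map (fun x : ℝ => (x : ℂ)) ^ k = (L ^ k).map (fun x : ℝ => (x : ℂ)) :=
    (Matrix.map_pow L Complex.ofRealHom k).symm
  simp [funext_iff, Fin.forall_iff, hpow, ctrbMatSet, Matrix.vecMul, dotProduct]

lemma ctrbMatSet_rank_eq_iff {n : ℕ} (L : Matrix (Fin n) (Fin n) ℝ) (S : Finset (Fin n)) :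
    (ctrbMatSet L S).rank = n ↔ ∀ v : Fin n → ℂ,
      (∀ k < n, ∀ s ∈ S, (v ᵥ* L.map (fun x : ℝ => (x : ℂ)) ^ k) s = 0) → v = 0 := by
  rw [Matrix.rank_eq_card_iff_forall_vecMul_eq_zero, forall_vecMul_map_ofReal_iff]
  simp only [vecMul_ctrbMatSet_map_eq_zero_iff]

/-- By Cayley–Hamilton the powers below `n` control all powers. -/
lemma vecMul_pow_apply_eq_zero_of_lt {n : ℕ} {M : Matrix (Fin n) (Fin n) ℂ} {v : Fin n → ℂ}
    {s : Fin n} (h : ∀ k < n, (v ᵥ* M ^ k) s = 0) (k : ℕ) : (v ᵥ* M ^ k) s = 0 := by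
  have hn : n ≠ 0 := fun h0 => (h0 ▸ s).elim0
  have hone : M.charpoly ≠ 1 := fun h1 => hn <| by
    simpa using (Matrix.charpoly_natDegree_eq_dim M).symm.trans (by rw [h1]; simp)
  have hdeg : (Polynomial.X ^ k %ₘ M.charpoly).natDegree < n := by
    simpa using Polynomial.natDegree_modByMonic_lt (Polynomial.X ^ k) M.charpoly_monic hone
  rw [Matrix.pow_eq_aeval_mod_charpoly, Polynomial.aeval_eq_sum_range' hdeg, Matrix.vecMul_sum,
    Finset.sum_apply]
  refine Finset.sum_eq_zero fun i hi => ?_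
  rw [Matrix.vecMul_smul, Pi.smul_apply, h i (Finset.mem_range.mp hi), smul_zero]

/-- Popov–Belevitch–Hautus: if no left eigenvector vanishes on `S`, then no nonzero row vector
annihilates the reachable space of `S`. -/
lemma eq_zero_of_forall_left_eigenvector {n : ℕ} {M : Matrix (Fin n) (Fin n) ℂ}
    {S : Finset (Fin n)}
    (hS : ∀ μ : ℂ, ∀ v : Fin n → ℂ, v ᵥ* M = μ • v → (∀ s ∈ S, v s = 0) → v = 0)
    {v : Fin n → ℂ} (hv : ∀ k < n, ∀ s ∈ S, (v ᵥ* M ^ k) s = 0) : v = 0 := by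
  let V : Submodule ℂ (Fin n → ℂ) :=
    { carrier := {u | ∀ k, ∀ s ∈ S, (u ᵥ* M ^ k) s = 0}
      add_mem' := fun {a b} ha hb k s hs => by
        rw [Matrix.add_vecMul, Pi.add_apply, ha k s hs, hb k s hs, add_zero]
      zero_mem' := fun k s hs => by simp
      smul_mem' := fun c a ha k s hs => by
        rw [Matrix.smul_vecMul, Pi.smul_apply, ha k s hs, smul_zero] }
  have hVv : v ∈ V := fun k s hs => vecMul_pow_apply_eq_zero_of_lt (fun j hj => hv j hj s hs) k
  have hmaps : ∀ u ∈ V, M.vecMulLinear u ∈ V := fun u hu k s hs => by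
    rw [Matrix.vecMulLinear_apply, Matrix.vecMul_vecMul, ← pow_succ']
    exact hu (k + 1) s hs
  by_contra hv0
  have : Nontrivial V := ⟨⟨v, hVv⟩, 0, fun h => hv0 (congrArg Subtype.val h)⟩
  obtain ⟨μ, hμ⟩ := Module.End.exists_eigenvalue (M.vecMulLinear.restrict hmaps)
  obtain ⟨u, hu⟩ := hμ.exists_hasEigenvector
  refine hu.2 (Subtype.ext (hS μ u ?_ fun s hs => ?_))
  · simpa using congrArg Subtype.val hu.apply_eq_smul
  · simpa using u.2 0 s hs

/-- Let `L` be the Laplacian of a weighted directed graph, with distinct complex eigenvalues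
`λ_0, …, λ_t` (the roots of the characteristic polynomial of the complexification `Lc`) of
geometric multiplicities `k_0, …, k_t`, and let `k = max {k_0, …, k_t}`.  If `r` is the
minimum cardinality of a leader set `S` making the pair `(L, B_S)` controllable, then
`k ≤ r ≤ k_0 + k_1 + ⋯ + k_t`. -/
theorem fewest_leaders_bounds {n : ℕ}
    (w : Matrix (Fin n) (Fin n) ℝ)
    (hw_noloop : ∀ i, w i i = 0) (hw_nonneg : ∀ i j, 0 ≤ w i j)
    (L : Matrix (Fin n) (Fin n) ℝ)
    (hL : ∀ i j, L i j = if i = j then ∑ k, w i k else -w i j)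
    (r : ℕ)
    (hr : IsLeast {m : ℕ | ∃ S : Finset (Fin n), S.card = m ∧ (ctrbMatSet L S).rank = n} r) :
    ((L.map (fun x : ℝ => (x : ℂ))).charpoly.roots.toFinset.sup
        (geomMult (L.map (fun x : ℝ => (x : ℂ)))) ≤ r) ∧
    r ≤ ∑ μ ∈ (L.map (fun x : ℝ => (x : ℂ))).charpoly.roots.toFinset,
          geomMult (L.map (fun x : ℝ => (x : ℂ))) μ := by
  set M := L.map (fun x : ℝ => (x : ℂ))
  refine ⟨Finset.sup_le fun μ _ => ?_, ?_⟩
  · obtain ⟨S, rfl, hS⟩ := hr.1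
    rw [ctrbMatSet_rank_eq_iff] at hS
    rw [← finrank_ker_transpose_eq_geomMult]
    let f := (LinearMap.funLeft ℂ ℂ (Subtype.val : S → Fin n)).domRestrict
      (LinearMap.ker (Matrix.mulVecLin (M - μ • (1 : Matrix (Fin n) (Fin n) ℂ))ᵀ))
    have hf : Function.Injective f := by
      rw [← LinearMap.ker_eq_bot, LinearMap.ker_eq_bot']
      rintro ⟨v, hv⟩ hfv
      rw [mem_ker_transpose_sub_iff] at hv
      refine Subtype.ext (hS v fun k _ s hs => ?_)
      have hvs : v s = 0 := congrFun hfv ⟨s, hs⟩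
      rw [vecMul_pow_of_vecMul_eq_smul hv, Pi.smul_apply, hvs, smul_zero]
    simpa using LinearMap.finrank_le_finrank_of_injective hf
  · choose T hcard hT using fun μ : ℂ =>
      Submodule.exists_finset_card_le_finrank_forall_eq_zero
        (LinearMap.ker (Matrix.mulVecLin (M - μ • (1 : Matrix (Fin n) (Fin n) ℂ))ᵀ))
    simp only [finrank_ker_transpose_eq_geomMult] at hcard
    refine (hr.2 ⟨M.charpoly.roots.toFinset.biUnion T, rfl, ?_⟩).trans
      (Finset.card_biUnion_le.trans (Finset.sum_le_sum fun μ _ => hcard μ))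
    rw [ctrbMatSet_rank_eq_iff]
    refine fun v hv => eq_zero_of_forall_left_eigenvector (fun μ u hu hus => ?_) hv
    by_contra hu0
    have hroot : μ ∈ M.charpoly.roots.toFinset := by
      rw [Multiset.mem_toFinset, Polynomial.mem_roots M.charpoly_monic.ne_zero]
      exact isRoot_charpoly_of_vecMul_eq_smul hu0 hu
    exact hu0 (hT μ u ((mem_ker_transpose_sub_iff M μ u).mpr hu)
      fun s hs => hus s (Finset.mem_biUnion.mpr ⟨μ, hroot, hs⟩))
end

section
/- Let G be a directed graph on vertex set {1,…,n} with edge set E (no self-loops) and let v be a vertex. There exists an assignment of positive weights w : E → ℝ_{>0} such that the pair (L_w, e_v) is controllable, where L_w is the Laplacian of the weighted graph (G, w), if and only if G contains a spanning tree rooted at v, i.e. every vertex of G is reachable from v. (In other words, the system is structurally controllable with single leader v iff the communication graph contains a spanning tree with root v.) -/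
open Matrix

/-- The Laplacian of the directed graph with edge relation `Adj` (`Adj u v` means there is
an edge `u → v`) and positive weights `w u v` on the edges `u → v`:
`L i j = -w j i` if `j → i` is an edge (`i ≠ j`), `0` if not, and
`L i i` is the sum of the weights of the edges into `i`. -/
noncomputable def lapOf {n : ℕ} (Adj : Fin n → Fin n → Prop) [DecidableRel Adj]
    (w : Fin n → Fin n → ℝ) : Matrix (Fin n) (Fin n) ℝ :=
  Matrix.of fun i j =>
    if i = j then ∑ m, (if Adj m i then w m i else 0)
    else -(if Adj j i then w j i else 0)

open Polynomial Filter Topology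

theorem lapOf_mulVec {n : ℕ} (Adj : Fin n → Fin n → Prop) [DecidableRel Adj]
    (hloop : ∀ u, ¬ Adj u u) (w : Fin n → Fin n → ℝ) (x : Fin n → ℝ) (i : Fin n) :
    (lapOf Adj w *ᵥ x) i = ∑ m, if Adj m i then w m i * (x i - x m) else 0 := by
  have h : ∀ j, lapOf Adj w i j * x j =
      (if i = j then (∑ m, if Adj m i then w m i else 0) * x i else 0)
        - (if Adj j i then w j i * x j else 0) := by
    intro j
    by_cases hij : i = j
    · subst hij
      simp [lapOf, hloop]
    · simp only [lapOf, Matrix.of_apply, if_neg hij]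
      split_ifs <;> ring
  simp only [Matrix.mulVec, dotProduct, h, Finset.sum_sub_distrib, Finset.sum_ite_eq,
    Finset.mem_univ, if_true]
  rw [Finset.sum_mul, ← Finset.sum_sub_distrib]
  refine Finset.sum_congr rfl fun m _ => ?_
  split_ifs <;> ring

/-- The controllable subspace is supported on the vertices reachable from the leader. -/
theorem pow_lapOf_mulVec_eq_zero_of_not_reachable {n : ℕ} (Adj : Fin n → Fin n → Prop)
    [DecidableRel Adj] (hloop : ∀ u, ¬ Adj u u) (v : Fin n) (w : Fin n → Fin n → ℝ) (k : ℕ)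
    (u : Fin n) (hu : ¬ Relation.ReflTransGen Adj v u) :
    ((lapOf Adj w ^ k) *ᵥ Pi.single v 1) u = 0 := by
  induction k generalizing u with
  | zero =>
    have : u ≠ v := by
      rintro rfl
      exact hu .refl
    simp [this]
  | succ k ih =>
    rw [pow_succ', ← Matrix.mulVec_mulVec, lapOf_mulVec Adj hloop]
    refine Finset.sum_eq_zero fun m _ => ?_
    split_ifs with hm
    · rw [ih u hu, ih m fun h => hu (h.tail hm), sub_zero, mul_zero]
    · rfl

theorem reachable_of_rank_ctrbMat_eq {n : ℕ} (Adj : Fin n → Fin n → Prop)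
    [DecidableRel Adj] (hloop : ∀ u, ¬ Adj u u) (v : Fin n) (w : Fin n → Fin n → ℝ)
    (h : (ctrbMat (lapOf Adj w) (Pi.single v 1)).rank = n) (u : Fin n) :
    Relation.ReflTransGen Adj v u := by
  by_contra hu
  have hle := Matrix.rank_le_card_of_support_subset (ctrbMat (lapOf Adj w) (Pi.single v 1))
    (Finset.univ.erase u) (by
      intro i hi
      simp only [Finset.coe_erase, Finset.coe_univ, Set.mem_sdiff, Set.mem_univ, true_and,
        Set.mem_singleton_iff]
      rintro rfl
      exact hi (funext fun k =>
        pow_lapOf_mulVec_eq_zero_of_not_reachable Adj hloop v w k i hu))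
  rw [h, Finset.card_erase_of_mem (Finset.mem_univ u), Finset.card_univ, Fintype.card_fin] at hle
  have := u.pos
  omega

/-- A vector annihilating the controllability matrix annihilates `(s - L)⁻¹ b`, for every `s`
that is not an eigenvalue. -/
theorem dotProduct_resolvent_eq_zero {n : ℕ} (L : Matrix (Fin n) (Fin n) ℝ) (b y x : Fin n → ℝ)
    (hy : y ᵥ* ctrbMat L b = 0) (s : ℝ) (hx : s • x - L *ᵥ x = b) (hs : L.charpoly.eval s ≠ 0) :
    y ⬝ᵥ x = 0 := by
  rcases Nat.eq_zero_or_pos n with rfl | hn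
  · simp
  set r := L.charpoly /ₘ (X - C s) with hr
  have hdeg : r.natDegree < n := by
    rw [hr, natDegree_divByMonic _ (monic_X_sub_C s), Matrix.charpoly_natDegree_eq_dim,
      Fintype.card_fin, natDegree_X_sub_C]
    omega
  have hyr : y ⬝ᵥ (aeval L r *ᵥ b) = 0 := by
    rw [aeval_eq_sum_range' hdeg, Matrix.sum_mulVec, dotProduct_sum]
    refine Finset.sum_eq_zero fun k hk => ?_
    rw [Matrix.smul_mulVec, dotProduct_smul]
    have := congrFun hy ⟨k, Finset.mem_range.1 hk⟩
    have hk0 : y ⬝ᵥ ((L ^ k) *ᵥ b) = 0 := this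
    rw [hk0, smul_zero]
  have hq : C (L.charpoly.eval s) + r * (X - C s) = L.charpoly := by
    rw [← modByMonic_X_sub_C_eq_C_eval, mul_comm]
    exact modByMonic_add_div _ _
  have hL := congrArg (fun q => aeval L q *ᵥ x) hq
  have hxb : (aeval L (X - C s)) *ᵥ x = -b := by
    rw [← hx]
    simp [Matrix.sub_mulVec, Algebra.algebraMap_eq_smul_one, Matrix.smul_mulVec]
  simp only [map_add, map_mul, Matrix.aeval_self_charpoly, Matrix.add_mulVec,
    ← Matrix.mulVec_mulVec, hxb, Matrix.zero_mulVec, Matrix.mulVec_neg, aeval_C,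
    Algebra.algebraMap_eq_smul_one, Matrix.smul_mulVec, Matrix.one_mulVec] at hL
  have := congrArg (y ⬝ᵥ ·) hL
  simp only [dotProduct_add, dotProduct_neg, hyr, dotProduct_smul, dotProduct_zero, neg_zero,
    add_zero, smul_eq_mul] at this
  exact (mul_eq_zero.1 this).resolve_left hs

/-- Along a rooted tree with parent map `p` and depth `ρ`, the resolvent vector, given at each
vertex by the product of the transfer functions along the path from the root. -/
noncomputable def treeResolvent {n : ℕ} (p : Fin n → Fin n) (ρ : Fin n → ℕ) (d : Fin n → ℝ)
    (v : Fin n) (s : ℝ) (u : Fin n) : ℝ :=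
  (∏ i ∈ Finset.range (ρ u), (-d (p^[i] u) / (s - d (p^[i] u)))) * (s - d v)⁻¹

section Tree

variable {n : ℕ} {p : Fin n → Fin n} {ρ : Fin n → ℕ} {d : Fin n → ℝ} {v : Fin n}

theorem treeResolvent_root (hv : ρ v = 0) (s : ℝ) :
    treeResolvent p ρ d v s v = (s - d v)⁻¹ := by
  simp [treeResolvent, hv]

theorem treeResolvent_of_ne (hρ : ∀ u, u ≠ v → ρ u = ρ (p u) + 1) (s : ℝ) {u : Fin n}
    (hu : u ≠ v) :
    treeResolvent p ρ d v s u = -d u / (s - d u) * treeResolvent p ρ d v s (p u) := by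
  simp only [treeResolvent, hρ u hu, Finset.prod_range_succ', Function.iterate_succ_apply,
    Function.iterate_zero_apply]
  ring

theorem treeResolvent_regular (hv : ρ v = 0) (hρ : ∀ u, u ≠ v → ρ u = ρ (p u) + 1)
    (hd : Function.Injective d) (hd0 : ∀ u, u ≠ v → d u ≠ 0) (a j : Fin n)
    (hj : j ≠ a) (hja : ρ j ≤ ρ a) :
    ContinuousAt (fun s => treeResolvent p ρ d v s j) (d a) ∧
      treeResolvent p ρ d v (d a) j ≠ 0 := by
  have hsub : ∀ j, j ≠ a → d a - d j ≠ 0 := fun j hj => sub_ne_zero.2 (hd.ne hj.symm)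
  induction hk : ρ j generalizing j with
  | zero =>
    have hjv : j = v := by
      by_contra h
      have := hρ j h
      omega
    subst hjv
    simp only [treeResolvent_root hv]
    exact ⟨(continuousAt_id.sub continuousAt_const).inv₀ (hsub j hj), inv_ne_zero (hsub j hj)⟩
  | succ k ih =>
    have hjv : j ≠ v := by
      rintro rfl
      omega
    have hp := hρ j hjv
    obtain ⟨hc, hne⟩ := ih (p j) (by rintro h; rw [h] at hp; omega) (by omega) (by omega)
    simp only [treeResolvent_of_ne hρ _ hjv]
    exact ⟨(continuousAt_const.div (continuousAt_id.sub continuousAt_const) (hsub j hj)).mul hc,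
      mul_ne_zero (div_ne_zero (neg_ne_zero.2 (hd0 j hjv)) (hsub j hj)) hne⟩

theorem exists_tendsto_sub_mul_treeResolvent (hv : ρ v = 0)
    (hρ : ∀ u, u ≠ v → ρ u = ρ (p u) + 1)
    (hd : Function.Injective d) (hd0 : ∀ u, u ≠ v → d u ≠ 0) (a : Fin n) :
    ∃ c ≠ 0, Tendsto (fun s => (s - d a) * treeResolvent p ρ d v s a) (𝓝[≠] (d a)) (𝓝 c) := by
  by_cases ha : a = v
  · subst ha
    refine ⟨1, one_ne_zero, tendsto_const_nhds.congr' ?_⟩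
    filter_upwards [self_mem_nhdsWithin] with s hs
    rw [treeResolvent_root hv, mul_inv_cancel₀ (sub_ne_zero.2 hs)]
  · have hp := hρ a ha
    obtain ⟨hc, hne⟩ := treeResolvent_regular hv hρ hd hd0 a (p a)
      (by rintro h; rw [h] at hp; omega) (by omega)
    refine ⟨-d a * treeResolvent p ρ d v (d a) (p a), mul_ne_zero (neg_ne_zero.2 (hd0 a ha)) hne,
      ((hc.tendsto.mono_left nhdsWithin_le_nhds).const_mul (-d a)).congr' ?_⟩
    filter_upwards [self_mem_nhdsWithin] with s hs
    have : s - d a ≠ 0 := sub_ne_zero.2 hs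
    rw [treeResolvent_of_ne hρ s ha]
    field_simp

/-- The resolvent functions of a tree with distinct weights are linearly independent: their poles
can be separated, starting from the deepest vertices. -/
theorem eq_zero_of_dotProduct_treeResolvent (hv : ρ v = 0)
    (hρ : ∀ u, u ≠ v → ρ u = ρ (p u) + 1)
    (hd : Function.Injective d) (hd0 : ∀ u, u ≠ v → d u ≠ 0) (y : Fin n → ℝ)
    (hy : ∀ᶠ s in cofinite, y ⬝ᵥ treeResolvent p ρ d v s = 0) : y = 0 := by
  by_contra hne
  obtain ⟨i, hi⟩ := Function.ne_iff.1 hne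
  obtain ⟨a, ha, hmax⟩ := Finset.exists_max_image (Finset.univ.filter fun u => y u ≠ 0) ρ
    ⟨i, by simpa using hi⟩
  obtain ⟨c, hc0, hc⟩ := exists_tendsto_sub_mul_treeResolvent hv hρ hd hd0 a
  have hrest : Tendsto (fun s => ∑ j ∈ Finset.univ.erase a, y j * treeResolvent p ρ d v s j)
      (𝓝[≠] (d a)) (𝓝 (∑ j ∈ Finset.univ.erase a, y j * treeResolvent p ρ d v (d a) j)) := by
    refine tendsto_finsetSum _ fun j hj => ?_
    by_cases hyj : y j = 0
    · simp [hyj]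
    · exact ((treeResolvent_regular hv hρ hd hd0 a j (Finset.ne_of_mem_erase hj)
        (hmax j (by simpa using hyj))).1.tendsto.mono_left nhdsWithin_le_nhds).const_mul _
  have hsub : Tendsto (fun s => s - d a) (𝓝[≠] (d a)) (𝓝 0) := by
    have : ContinuousAt (fun s => s - d a) (d a) := by fun_prop
    simpa using this.tendsto.mono_left (nhdsWithin_le_nhds (s := {d a}ᶜ))
  have hlim := (hc.const_mul (y a)).add (hsub.mul hrest)
  have hzero := hlim.congr' (f₂ := fun _ => (0 : ℝ)) (by
    filter_upwards [nhdsNE_le_cofinite (d a) hy] with s hs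
    have hs : ∑ j, y j * treeResolvent p ρ d v s j = 0 := hs
    rw [← Finset.add_sum_erase _ _ (Finset.mem_univ a)] at hs
    linear_combination (s - d a) * hs)
  have := tendsto_nhds_unique hzero tendsto_const_nhds
  rw [zero_mul, add_zero] at this
  exact mul_ne_zero (by simpa using ha) hc0 this

/-- Putting the weight `d u` on the tree edge into `u` and zero elsewhere gives a controllable
pair, provided the weights are distinct. -/
theorem det_ctrbMat_tree_ne_zero (Adj : Fin n → Fin n → Prop) [DecidableRel Adj]
    (hloop : ∀ u, ¬ Adj u u) (hadj : ∀ u, u ≠ v → Adj (p u) u) (hv : ρ v = 0)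
    (hρ : ∀ u, u ≠ v → ρ u = ρ (p u) + 1) (hd : Function.Injective d)
    (hdv : d v = 0) (hd0 : ∀ u, u ≠ v → d u ≠ 0) :
    (ctrbMat (lapOf Adj fun a b => if a = p b then d b else 0) (Pi.single v 1)).det ≠ 0 := by
  set L := lapOf Adj fun a b => if a = p b then d b else 0 with hL
  intro hdet
  obtain ⟨y, hy0, hy⟩ := Matrix.exists_vecMul_eq_zero_iff.2 hdet
  refine hy0 (eq_zero_of_dotProduct_treeResolvent hv hρ hd hd0 y ?_)
  have hroot : ∀ᶠ s in cofinite, L.charpoly.eval s ≠ 0 := by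
    have := L.charpoly.rootSet_finite ℝ
    filter_upwards [this.compl_mem_cofinite] with s hs h0
    exact hs ((mem_rootSet_of_ne L.charpoly_monic.ne_zero).2 (by simpa [aeval_def] using h0))
  filter_upwards [hroot, (Set.finite_range d).compl_mem_cofinite] with s hs hsd
  have hsd : ∀ u, s - d u ≠ 0 := fun u h => hsd ⟨u, (sub_eq_zero.1 h).symm⟩
  refine dotProduct_resolvent_eq_zero L _ y _ hy s ?_ hs
  funext u
  rw [Pi.sub_apply, hL, lapOf_mulVec Adj hloop, Pi.smul_apply, smul_eq_mul]
  by_cases hu : u = v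
  · subst hu
    have := hsd u
    rw [hdv, sub_zero] at this
    simp [hdv, treeResolvent_root hv, this]
  · rw [Finset.sum_eq_single (p u) (by intro m _ hm; simp [hm]) (by simp)]
    have := hsd u
    simp only [hadj u hu, if_true, Pi.single_eq_of_ne hu, treeResolvent_of_ne hρ s hu]
    field_simp
    ring

end Tree

/-- `ReachableIn Adj v k u` says that there is a walk of length `k` from `v` to `u`. -/
def ReachableIn {α : Type*} (Adj : α → α → Prop) (v : α) : ℕ → α → Prop
  | 0, u => u = v
  | k + 1, u => ∃ m, Adj m u ∧ ReachableIn Adj v k m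

/-- If every vertex is reachable from `v` then there is a breadth-first spanning tree, given by
its parent map and depth function. -/
theorem exists_spanning_tree {α : Type*} (Adj : α → α → Prop) (v : α)
    (h : ∀ u, Relation.ReflTransGen Adj v u) :
    ∃ (p : α → α) (ρ : α → ℕ), ρ v = 0 ∧ ∀ u, u ≠ v → Adj (p u) u ∧ ρ u = ρ (p u) + 1 := by
  classical
  have hex : ∀ u, ∃ k, ReachableIn Adj v k u := by
    intro u
    induction h u with
    | refl => exact ⟨0, rfl⟩
    | tail _ hab ih =>
      obtain ⟨k, hk⟩ := ih
      exact ⟨k + 1, _, hab, hk⟩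
  have hp : ∀ u, ∃ m, u ≠ v → Adj m u ∧ Nat.find (hex u) = Nat.find (hex m) + 1 := by
    intro u
    by_cases hu : u = v
    · exact ⟨v, fun h => absurd hu h⟩
    have hspec := Nat.find_spec (hex u)
    cases hk : Nat.find (hex u) with
    | zero =>
      rw [hk] at hspec
      exact absurd hspec hu
    | succ k =>
      rw [hk] at hspec
      obtain ⟨m, hm, hkm⟩ := hspec
      have h1 := Nat.find_min' (hex m) hkm
      have h2 := Nat.find_min' (hex u) (m := Nat.find (hex m) + 1)
        ⟨m, hm, Nat.find_spec (hex m)⟩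
      exact ⟨m, fun _ => ⟨hm, by omega⟩⟩
  choose p hp using hp
  exact ⟨p, fun u => Nat.find (hex u), (Nat.find_eq_zero _).2 rfl, hp⟩

theorem continuous_det_ctrbMat_lapOf {n : ℕ} (Adj : Fin n → Fin n → Prop) [DecidableRel Adj]
    (b : Fin n → ℝ) : Continuous fun w => (ctrbMat (lapOf Adj w) b).det := by
  have hL : Continuous fun w => lapOf Adj w := by
    refine continuous_matrix fun i j => ?_
    simp only [lapOf, Matrix.of_apply]
    split_ifs
    · refine continuous_finsetSum _ fun m _ => ?_
      split_ifs <;> fun_prop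
    · fun_prop
    · fun_prop
  refine Continuous.matrix_det (continuous_matrix fun i k => ?_)
  exact (continuous_apply i).comp ((hL.pow _).matrix_mulVec continuous_const)

/-- **Structural controllability with a single leader.**
Let `G` be a directed graph on `n` vertices with edge relation `Adj` (no self-loops) and
let `v` be a vertex.  There exists an assignment of positive weights to the edges making
the pair `(L_w, e_v)` controllable iff `G` contains a spanning tree rooted at `v`, i.e.
every vertex is reachable from `v`. -/
theorem structurally_controllable_iff_spanning_tree {n : ℕ}
    (Adj : Fin n → Fin n → Prop) [DecidableRel Adj]
    (hloop : ∀ u, ¬ Adj u u) (v : Fin n) :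
    (∃ w : Fin n → Fin n → ℝ, (∀ a b, Adj a b → 0 < w a b) ∧
      (ctrbMat (lapOf Adj w) (Pi.single v 1)).rank = n) ↔
    ∀ u : Fin n, Relation.ReflTransGen Adj v u := by
  constructor
  · rintro ⟨w, -, hw⟩
    exact reachable_of_rank_ctrbMat_eq Adj hloop v w hw
  · intro h
    obtain ⟨p, ρ, hv, hp⟩ := exists_spanning_tree Adj v h
    let d : Fin n → ℝ := fun u => if u = v then 0 else (u : ℝ) + 1
    have hd_nonneg : ∀ u, 0 ≤ d u := fun u => by
      simp only [d]
      split_ifs <;> positivity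
    have hd0 : ∀ u, u ≠ v → d u ≠ 0 := fun u hu => by
      simp only [d, if_neg hu]
      positivity
    have hdv : d v = 0 := if_pos rfl
    have hd : Function.Injective d := by
      intro a b hab
      by_cases ha : a = v
      · by_contra hne
        rw [ha, hdv] at hab
        exact hd0 b (fun hb => hne (ha.trans hb.symm)) hab.symm
      · by_cases hb : b = v
        · rw [hb, hdv] at hab
          exact absurd hab (hd0 a ha)
        · simp only [d, if_neg ha, if_neg hb, add_left_inj, Nat.cast_inj] at hab
          exact Fin.ext hab
    have hdet := det_ctrbMat_tree_ne_zero Adj hloop (fun u hu => (hp u hu).1) hv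
      (fun u hu => (hp u hu).2) hd hdv hd0
    set w₀ : Fin n → Fin n → ℝ := fun a b => if a = p b then d b else 0 with hw₀
    have hcont : Continuous fun ε : ℝ =>
        (ctrbMat (lapOf Adj fun a b => w₀ a b + ε) (Pi.single v 1)).det :=
      (continuous_det_ctrbMat_lapOf Adj _).comp (by fun_prop)
    have hev : ∀ᶠ ε in 𝓝 (0 : ℝ),
        (ctrbMat (lapOf Adj fun a b => w₀ a b + ε) (Pi.single v 1)).det ≠ 0 :=
      hcont.continuousAt.eventually_ne (by simpa using hdet)
    obtain ⟨ε, hε, hε0⟩ :=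
      ((hev.filter_mono nhdsWithin_le_nhds).and (self_mem_nhdsWithin (s := Set.Ioi 0))).exists
    refine ⟨fun a b => w₀ a b + ε, fun a b _ => ?_, ?_⟩
    · have : 0 ≤ w₀ a b := by
        simp only [hw₀]
        split_ifs
        exacts [hd_nonneg b, le_rfl]
      exact add_pos_of_nonneg_of_pos this hε0
    · simpa using Matrix.rank_of_det_ne_zero hε
end

section
/- Let G be a directed graph on vertex set {1,…,n} with edge set E (no self-loops), and let S ⊆ {1,…,n} be a set of leaders. There exists an assignment of positive weights w : E → ℝ_{>0} such that the pair (L_w, B_S) is controllable, where L_w is the Laplacian of (G, w) and B_S is the matrix whose columns are the standard basis vectors e_i for i ∈ S, if and only if every vertex of G is reachable from some vertex of S. Consequently, the minimum number of leaders with which G is structurally controllable equals the minimum number r of trees in a spanning forest of G (equivalently, the minimum cardinality of a vertex set from which every vertex of G is reachable), and it is achieved by taking the r roots of a minimal spanning forest as the leaders. -/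
open Matrix

section Rank

variable {n : ℕ} {ι : Type*} [Fintype ι]

lemma rank_eq_iff_linearIndependent_row (C : Matrix (Fin n) ι ℝ) :
    C.rank = n ↔ LinearIndependent ℝ C.row := by
  rw [linearIndependent_iff_card_eq_finrank_span, C.rank_eq_finrank_span_row, Fintype.card_fin,
    Set.finrank, eq_comm]

lemma rank_eq_iff_det_mul_transpose_ne_zero (C : Matrix (Fin n) ι ℝ) :
    C.rank = n ↔ (C * Cᵀ).det ≠ 0 := by
  rw [← Matrix.rank_self_mul_transpose, rank_eq_iff_linearIndependent_row,
    Matrix.linearIndependent_rows_iff_isUnit, Matrix.isUnit_iff_isUnit_det, isUnit_iff_ne_zero]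

end Rank

section Controllability

variable {n : ℕ}

lemma pow_mem_span_lower_powers {K : Type*} [Field K] (A : Matrix (Fin n) (Fin n) K) (k : ℕ) :
    ∃ c : ℕ → K, A ^ k = ∑ i ∈ Finset.range n, c i • A ^ i := by
  rcases Nat.eq_zero_or_pos n with rfl | hn
  · exact ⟨0, Subsingleton.elim _ _⟩
  · refine ⟨(Polynomial.X ^ k %ₘ A.charpoly).coeff, ?_⟩
    rw [Matrix.pow_eq_aeval_mod_charpoly, ← Polynomial.aeval_eq_sum_range']
    have h := Polynomial.natDegree_modByMonic_lt (Polynomial.X ^ k) A.charpoly_monic (by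
      intro h
      have := A.charpoly_natDegree_eq_dim
      rw [h, Polynomial.natDegree_one, Fintype.card_fin] at this
      omega)
    rwa [A.charpoly_natDegree_eq_dim, Fintype.card_fin] at h

/-- The left vectors annihilated by every `A ^ k e_s`, `s ∈ S`. -/
def unreachableLeftSpace (A : Matrix (Fin n) (Fin n) ℂ) (S : Finset (Fin n)) :
    Submodule ℂ (Fin n → ℂ) where
  carrier := {y | ∀ k : ℕ, ∀ s ∈ S, (y ᵥ* A ^ k) s = 0}
  add_mem' := by
    intro x y hx hy k s hs
    simp [Matrix.add_vecMul, hx k s hs, hy k s hs]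
  zero_mem' := by
    intro k s _
    simp
  smul_mem' := by
    intro c y hy k s hs
    simp [Matrix.smul_vecMul, hy k s hs]

/-- The eigenvector test for controllability. -/
lemma rank_ctrbMatSet_eq_of_eigenvector_test (L : Matrix (Fin n) (Fin n) ℝ) (S : Finset (Fin n))
    (H : ∀ (μ : ℂ) (y : Fin n → ℂ), y ᵥ* L.map Complex.ofReal = μ • y →
      (∀ s ∈ S, y s = 0) → y = 0) :
    (ctrbMatSet L S).rank = n := by
  rw [rank_eq_iff_linearIndependent_row, ← Matrix.vecMul_injective_iff]
  set A := L.map Complex.ofReal with hA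
  set V := unreachableLeftSpace A S with hV
  have hinv : ∀ y ∈ V, A.vecMulLinear y ∈ V := by
    intro y hy k s hs
    have := hy (k + 1) s hs
    rwa [pow_succ', ← Matrix.vecMul_vecMul] at this
  have hbot : V = ⊥ := by
    by_contra hne
    have : Nontrivial V := Submodule.nontrivial_iff_ne_bot.mpr hne
    obtain ⟨μ, hμ⟩ := Module.End.exists_eigenvalue (A.vecMulLinear.restrict hinv)
    obtain ⟨y, hy⟩ := hμ.exists_hasEigenvector
    apply hy.2
    apply Subtype.ext
    refine H μ y ?_ ?_
    · simpa using congrArg Subtype.val hy.apply_eq_smul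
    · intro s hs
      simpa using y.2 0 s hs
  rw [← Matrix.coe_vecMulLinear, injective_iff_map_eq_zero]
  intro y hy
  have hlow : ∀ k < n, ∀ s ∈ S, (y ᵥ* L ^ k) s = 0 := by
    intro k hk s hs
    have := congrFun hy (⟨k, hk⟩, ⟨s, hs⟩)
    simpa [ctrbMatSet, Matrix.vecMul, dotProduct] using this
  have hall : ∀ k, ∀ s ∈ S, (y ᵥ* L ^ k) s = 0 := by
    intro k s hs
    obtain ⟨c, hc⟩ := pow_mem_span_lower_powers L k
    rw [hc, Matrix.vecMul_sum, Finset.sum_apply]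
    refine Finset.sum_eq_zero fun i hi => ?_
    rw [Matrix.vecMul_smul, Pi.smul_apply, hlow i (Finset.mem_range.mp hi) s hs, smul_zero]
  have hmem : (fun i => (y i : ℂ)) ∈ V := by
    intro k s hs
    have h1 : A ^ k = (L ^ k).map Complex.ofReal :=
      (map_pow (Complex.ofRealHom.mapMatrix) L k).symm
    rw [h1]
    have := congrArg Complex.ofReal (hall k s hs)
    simpa [Matrix.vecMul, dotProduct] using this
  rw [hbot, Submodule.mem_bot] at hmem
  funext i
  simpa using congrFun hmem i

lemma continuous_det_ctrbMatSet_mul_transpose {L : ℝ → Matrix (Fin n) (Fin n) ℝ}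
    (hL : Continuous L) (S : Finset (Fin n)) :
    Continuous fun ε => (ctrbMatSet (L ε) S * (ctrbMatSet (L ε) S)ᵀ).det := by
  have hC : Continuous fun ε => ctrbMatSet (L ε) S := by
    refine continuous_matrix fun i p => ?_
    exact (continuous_apply i).comp ((hL.pow _).matrix_mulVec continuous_const)
  exact (hC.matrix_mul hC.matrix_transpose).matrix_det

end Controllability

section Graph

variable {n : ℕ}

lemma reflTransGen_of_pow_lapOf_mulVec_ne_zero (Adj : Fin n → Fin n → Prop) [DecidableRel Adj]
    (w : Fin n → Fin n → ℝ) (s : Fin n) (k : ℕ) (u : Fin n)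
    (h : ((lapOf Adj w ^ k) *ᵥ Pi.single s 1) u ≠ 0) : Relation.ReflTransGen Adj s u := by
  induction k generalizing u with
  | zero =>
    rcases eq_or_ne u s with rfl | hus
    · exact .refl
    · simp [hus] at h
  | succ k ih =>
    rw [pow_succ', ← Matrix.mulVec_mulVec, Matrix.mulVec, dotProduct] at h
    obtain ⟨j, -, hj⟩ := Finset.exists_ne_zero_of_sum_ne_zero h
    have hreach := ih j (right_ne_zero_of_mul hj)
    rcases eq_or_ne u j with rfl | huj
    · exact hreach
    · have hadj : Adj j u := by
        by_contra hn
        exact hj (by simp [lapOf, huj, hn])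
      exact hreach.tail hadj

lemma forall_reachable_of_rank_ctrbMatSet_eq (Adj : Fin n → Fin n → Prop) [DecidableRel Adj]
    (w : Fin n → Fin n → ℝ) (S : Finset (Fin n)) (h : (ctrbMatSet (lapOf Adj w) S).rank = n)
    (u : Fin n) : ∃ s ∈ S, Relation.ReflTransGen Adj s u := by
  by_contra! hu
  refine (rank_eq_iff_linearIndependent_row _).mp h |>.ne_zero u (funext fun p => ?_)
  by_contra hp
  exact hu p.2 p.2.2 (reflTransGen_of_pow_lapOf_mulVec_ne_zero Adj w p.2 p.1 u hp)

/-- There is a directed walk of length `k` from a vertex of `S` to the given vertex. -/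
def HasWalkFrom (Adj : Fin n → Fin n → Prop) (S : Finset (Fin n)) : ℕ → Fin n → Prop
  | 0, u => u ∈ S
  | k + 1, u => ∃ p, HasWalkFrom Adj S k p ∧ Adj p u

/-- A spanning forest with root set `S`, given by a parent map and a depth function. -/
lemma exists_parent_depth (Adj : Fin n → Fin n → Prop) (S : Finset (Fin n))
    (h : ∀ u, ∃ s ∈ S, Relation.ReflTransGen Adj s u) :
    ∃ (p : Fin n → Fin n) (d : Fin n → ℕ), ∀ u ∉ S, Adj (p u) u ∧ d u = d (p u) + 1 := by
  classical
  have hw : ∀ u, ∃ k, HasWalkFrom Adj S k u := by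
    intro u
    obtain ⟨s, hs, hsu⟩ := h u
    induction hsu with
    | refl => exact ⟨0, hs⟩
    | tail _ hbc ih =>
      obtain ⟨k, hk⟩ := ih
      exact ⟨k + 1, _, hk, hbc⟩
  have key : ∀ u, ∃ q, u ∉ S → Adj q u ∧ Nat.find (hw u) = Nat.find (hw q) + 1 := by
    intro u
    by_cases hu : u ∈ S
    · exact ⟨u, fun h => absurd hu h⟩
    have hspec := Nat.find_spec (hw u)
    generalize hd : Nat.find (hw u) = k at hspec
    cases k with
    | zero => exact absurd hspec hu
    | succ k =>
      obtain ⟨q, hq, hqu⟩ := hspec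
      refine ⟨q, fun _ => ⟨hqu, ?_⟩⟩
      have h1 : Nat.find (hw q) ≤ k := Nat.find_min' _ hq
      have h2 : Nat.find (hw u) ≤ Nat.find (hw q) + 1 :=
        Nat.find_min' _ ⟨q, Nat.find_spec (hw q), hqu⟩
      omega
  choose p hp using key
  exact ⟨p, fun u => Nat.find (hw u), hp⟩

/-- Left eigenvectors of a forest Laplacian with distinct weights do not vanish on the roots. -/
lemma eq_zero_of_forest_eigenvector (S : Finset (Fin n)) (p : Fin n → Fin n) (d : Fin n → ℕ)
    (hd : ∀ u ∉ S, d u = d (p u) + 1) (a : Fin n → ℂ) (ha : Function.Injective a)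
    (ha0 : ∀ u, a u ≠ 0) (μ : ℂ) (y : Fin n → ℂ) (hS : ∀ s ∈ S, y s = 0)
    (hy : ∀ j ∉ S, a j * y j - ∑ i with i ∉ S ∧ p i = j, a i * y i = μ * y j)
    (hyS : ∀ j ∈ S, ∑ i with i ∉ S ∧ p i = j, a i * y i = 0) : y = 0 := by
  by_contra hne
  have hchild : ∀ u, y u ≠ 0 → a u = μ ∨ ∃ c, y c ≠ 0 ∧ c ∉ S ∧ p c = u := by
    intro u hu
    by_contra! hcon
    have huS : u ∉ S := fun h => hu (hS u h)
    have h0 : ∑ i with i ∉ S ∧ p i = u, a i * y i = 0 := by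
      refine Finset.sum_eq_zero fun i hi => ?_
      simp only [Finset.mem_filter, Finset.mem_univ, true_and] at hi
      by_contra hi0
      exact hcon.2 i (right_ne_zero_of_mul hi0) hi.1 hi.2
    have := hy u huS
    rw [h0, sub_zero] at this
    exact hcon.1 (mul_right_cancel₀ hu this)
  obtain ⟨N, hN⟩ : ∃ N, ∀ u, d u ≤ N :=
    ⟨Finset.univ.sup d, fun u => Finset.le_sup (Finset.mem_univ u)⟩
  -- Every vertex of the support is an ancestor of the vertex whose weight is `μ`.
  have hanc : ∀ m u, N - d u = m → y u ≠ 0 → ∃ v, a v = μ ∧ d u ≤ d v ∧ p^[d v - d u] v = u := by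
    intro m
    induction m with
    | zero =>
      intro u hm hu
      rcases hchild u hu with h | ⟨c, -, hcS, rfl⟩
      · exact ⟨u, h, le_rfl, by simp⟩
      · have := hd c hcS
        have := hN c
        omega
    | succ m ih =>
      intro u hm hu
      rcases hchild u hu with h | ⟨c, hc, hcS, rfl⟩
      · exact ⟨u, h, le_rfl, by simp⟩
      · have hdc := hd c hcS
        obtain ⟨v, hv, hle, hvc⟩ := ih c (by omega) hc
        refine ⟨v, hv, by omega, ?_⟩
        rw [show d v - d (p c) = (d v - d c) + 1 by omega, Function.iterate_succ_apply', hvc]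
  have huniq : ∀ u u', y u ≠ 0 → y u' ≠ 0 → d u = d u' → u = u' := by
    intro u u' hu hu' hdd
    obtain ⟨v, hv, -, hvu⟩ := hanc _ u rfl hu
    obtain ⟨v', hv', -, hvu'⟩ := hanc _ u' rfl hu'
    obtain rfl : v = v' := ha (hv.trans hv'.symm)
    rw [← hvu, ← hvu', hdd]
  obtain ⟨u₀, hu₀⟩ := Function.ne_iff.mp hne
  obtain ⟨u, hu, hmin⟩ := Finset.exists_min_image (Finset.univ.filter fun u => y u ≠ 0) d
    ⟨u₀, by simpa using hu₀⟩
  simp only [Finset.mem_filter, Finset.mem_univ, true_and] at hu hmin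
  have huS : u ∉ S := fun h => hu (hS u h)
  have hpu : y (p u) = 0 := by
    by_contra h
    have := hmin _ h
    have := hd u huS
    omega
  have hsum : ∑ i with i ∉ S ∧ p i = p u, a i * y i = a u * y u := by
    refine Finset.sum_eq_single_of_mem u (by simp [huS]) fun i hi hiu => ?_
    simp only [Finset.mem_filter, Finset.mem_univ, true_and] at hi
    by_contra hi0
    refine hiu (huniq i u (right_ne_zero_of_mul hi0) hu ?_)
    rw [hd i hi.1, hd u huS, hi.2]
  refine mul_ne_zero (ha0 u) hu ?_
  rw [← hsum]
  by_cases hpS : p u ∈ S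
  · exact hyS _ hpS
  · simpa [hpu] using hy _ hpS

/-- Distinct weights on the edges of the forest with parent map `p`, and weight `ε` on all
other edges. -/
noncomputable def forestWeight (S : Finset (Fin n)) (p : Fin n → Fin n) (ε : ℝ)
    (a b : Fin n) : ℝ :=
  if b ∉ S ∧ p b = a then (b : ℝ) + 1 else ε

lemma continuous_lapOf_forestWeight (Adj : Fin n → Fin n → Prop) [DecidableRel Adj]
    (S : Finset (Fin n)) (p : Fin n → Fin n) :
    Continuous fun ε => lapOf Adj (forestWeight S p ε) := by
  have hw : ∀ a b, Continuous fun ε => forestWeight S p ε a b := by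
    intro a b
    unfold forestWeight
    split_ifs <;> fun_prop
  have hw' : ∀ a b, Continuous fun ε => if Adj a b then forestWeight S p ε a b else 0 := by
    intro a b
    split_ifs
    exacts [hw a b, continuous_const]
  refine continuous_matrix fun i j => ?_
  simp only [lapOf, Matrix.of_apply]
  split_ifs
  · exact continuous_finsetSum _ fun m _ => hw' m i
  · exact (hw j i).neg
  · fun_prop

lemma rank_ctrbMatSet_forestWeight_zero (Adj : Fin n → Fin n → Prop) [DecidableRel Adj]
    (S : Finset (Fin n)) (p : Fin n → Fin n) (d : Fin n → ℕ)
    (h : ∀ u ∉ S, Adj (p u) u ∧ d u = d (p u) + 1) :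
    (ctrbMatSet (lapOf Adj (forestWeight S p 0)) S).rank = n := by
  refine rank_ctrbMatSet_eq_of_eigenvector_test _ _ fun μ y hy hS => ?_
  have hwt : ∀ m i, (if Adj m i then forestWeight S p 0 m i else 0)
      = if i ∉ S ∧ p i = m then (i : ℝ) + 1 else 0 := by
    intro m i
    unfold forestWeight
    by_cases hi : i ∉ S ∧ p i = m
    · simp [hi, hi.2 ▸ (h i hi.1).1]
    · simp [hi]
  have hpne : ∀ i ∉ S, p i ≠ i := by
    intro i hi hpi
    have := (h i hi).2
    rw [hpi] at this
    omega
  have hcol : ∀ j, (if j ∉ S then ((j : ℂ) + 1) * y j else 0)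
      - ∑ i with i ∉ S ∧ p i = j, ((i : ℂ) + 1) * y i = μ * y j := by
    intro j
    rw [← smul_eq_mul μ, ← Pi.smul_apply, ← hy, Matrix.vecMul, dotProduct,
      ← Finset.add_sum_erase _ _ (Finset.mem_univ j), sub_eq_add_neg]
    congr 1
    · simp only [lapOf, hwt, Matrix.map_apply, Matrix.of_apply, if_true]
      by_cases hj : j ∈ S <;> simp [hj, mul_comm]
    · rw [← Finset.sum_neg_distrib, Finset.sum_filter,
        ← Finset.add_sum_erase _ _ (Finset.mem_univ j), if_neg fun hj => hpne j hj.1 hj.2, zero_add]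
      refine Finset.sum_congr rfl fun i hi => ?_
      simp only [lapOf, hwt, Matrix.map_apply, Matrix.of_apply, if_neg (Finset.ne_of_mem_erase hi)]
      split_ifs
      · push_cast
        ring
      · simp
  refine eq_zero_of_forest_eigenvector S p d (fun u hu => (h u hu).2) (fun i => (i : ℂ) + 1)
    ?_ (fun u => Nat.cast_add_one_ne_zero _) μ y hS ?_ ?_
  · intro i j hij
    exact Fin.ext (by simpa using hij)
  · intro j hj
    simpa [hj] using hcol j
  · intro j hj
    simpa [hj, hS j hj] using hcol j

lemma exists_rank_ctrbMatSet_eq (Adj : Fin n → Fin n → Prop) [DecidableRel Adj]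
    (S : Finset (Fin n)) (h : ∀ u, ∃ s ∈ S, Relation.ReflTransGen Adj s u) :
    ∃ w : Fin n → Fin n → ℝ, (∀ a b, Adj a b → 0 < w a b) ∧
      (ctrbMatSet (lapOf Adj w) S).rank = n := by
  obtain ⟨p, d, hpd⟩ := exists_parent_depth Adj S h
  have hcont := continuous_det_ctrbMatSet_mul_transpose (continuous_lapOf_forestWeight Adj S p) S
  have h0 := (rank_eq_iff_det_mul_transpose_ne_zero _).mp
    (rank_ctrbMatSet_forestWeight_zero Adj S p d hpd)
  have hev := (hcont.continuousAt.eventually_ne h0).filter_mono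
    (nhdsWithin_le_nhds (s := Set.Ioi 0))
  obtain ⟨ε, hε, hpos⟩ := (hev.and self_mem_nhdsWithin).exists
  refine ⟨forestWeight S p ε, fun a b _ => ?_,
    (rank_eq_iff_det_mul_transpose_ne_zero _).mpr hε⟩
  unfold forestWeight
  split_ifs
  exacts [by positivity, hpos]

end Graph

/-- **Structural controllability with multiple leaders.**
Let `G` be a directed graph on `n` vertices with edge relation `Adj` (no self-loops).
For a leader set `S`, there exist positive edge weights making the pair `(L_w, B_S)`
controllable iff every vertex of `G` is reachable from some vertex of `S`.  Consequently,
the minimum number of leaders with which `G` is structurally controllable equals the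
minimum number of trees in a spanning forest of `G`, i.e. the minimum cardinality of a
vertex set from which every vertex is reachable (the roots of a minimal spanning forest). -/
theorem structurally_controllable_leader_sets {n : ℕ}
    (Adj : Fin n → Fin n → Prop) [DecidableRel Adj]
    (hloop : ∀ u, ¬ Adj u u) :
    (∀ S : Finset (Fin n),
      ((∃ w : Fin n → Fin n → ℝ, (∀ a b, Adj a b → 0 < w a b) ∧
          (ctrbMatSet (lapOf Adj w) S).rank = n) ↔
        ∀ u : Fin n, ∃ s ∈ S, Relation.ReflTransGen Adj s u)) ∧
    sInf {m : ℕ | ∃ S : Finset (Fin n), S.card = m ∧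
        ∃ w : Fin n → Fin n → ℝ, (∀ a b, Adj a b → 0 < w a b) ∧
          (ctrbMatSet (lapOf Adj w) S).rank = n} =
      sInf {m : ℕ | ∃ S : Finset (Fin n), S.card = m ∧
        ∀ u : Fin n, ∃ s ∈ S, Relation.ReflTransGen Adj s u} := by
  have hiff : ∀ S : Finset (Fin n),
      ((∃ w : Fin n → Fin n → ℝ, (∀ a b, Adj a b → 0 < w a b) ∧
          (ctrbMatSet (lapOf Adj w) S).rank = n) ↔
        ∀ u : Fin n, ∃ s ∈ S, Relation.ReflTransGen Adj s u) := fun S =>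
    ⟨fun ⟨w, _, hw⟩ => forall_reachable_of_rank_ctrbMatSet_eq Adj w S hw,
      exists_rank_ctrbMatSet_eq Adj S⟩
  exact ⟨hiff, by simp only [hiff]⟩
end

section
/- Let G be a directed graph on {1,…,n} with edge set E, let w : E → ℝ_{>0} be positive weights with Laplacian L, and fix an edge e* ∈ E. For ε > 0, let L_ε be the Laplacian obtained by increasing the weight of e* by ε and keeping all other weights unchanged. If there exists some ε₀ > 0 such that rank(e_1, L_{ε₀} e_1, …, L_{ε₀}^{n−1} e_1) > rank(e_1, L e_1, …, L^{n−1} e_1), then the set of ε > 0 for which rank(e_1, L_ε e_1, …, L_ε^{n−1} e_1) fails to exceed rank(e_1, L e_1, …, L^{n−1} e_1) is finite, containing at most n − 1 values (the roots of a nonzero polynomial of degree at most n − 1 in ε). -/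
open Matrix

open Polynomial in
/-- Along the line `A + t • B`, where `B` has a zero column, the rank falls below any value it
attains for at most (number of columns) − 1 values of `t`. -/
theorem exists_finset_rank_lt_pencil {K m ι : Type*} [Field K] [Fintype m] [DecidableEq m]
    [Fintype ι] (A B : Matrix m ι K) (j : ι) (hB : ∀ i, B i j = 0) (t₀ : K) :
    ∃ s : Finset K, s.card ≤ Fintype.card ι - 1 ∧
      ∀ t, (A + t • B).rank < (A + t₀ • B).rank → t ∈ s := by
  classical
  obtain ⟨κ, f, hf, hspan, hli⟩ := exists_linearIndependent' K (A + t₀ • B).col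
  have : Fintype κ := Fintype.ofInjective f hf
  have hcard : Fintype.card κ = (A + t₀ • B).rank := by
    rw [rank_eq_finrank_span_cols, ← hspan, finrank_span_eq_card hli]
  have hinj : Function.Injective ((A + t₀ • B).submatrix id f).mulVec :=
    mulVec_injective_iff.2 hli
  obtain ⟨g, hg⟩ := ((A + t₀ • B).submatrix id f).mulVecLin.exists_leftInverse_of_injective
    (LinearMap.ker_eq_bot.2 hinj)
  set P := LinearMap.toMatrix' g
  have hP : P * (A + t₀ • B).submatrix id f = 1 := by
    have h := congrArg LinearMap.toMatrix' hg
    rwa [LinearMap.toMatrix'_comp, LinearMap.toMatrix'_id, ← Matrix.toLin'_apply',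
      LinearMap.toMatrix'_toLin'] at h
  set A' := P * A.submatrix id f
  set B' := P * B.submatrix id f with hB'
  have hpencil (t : K) : P * (A + t • B).submatrix id f = t • B' + A' := by
    rw [submatrix_add, submatrix_smul, Pi.add_apply, Pi.add_apply, Matrix.mul_add, add_comm]
    simp [A', B']
  let p : K[X] := det ((X : K[X]) • B'.map C + A'.map C)
  have heval (t : K) : p.eval t = (P * (A + t • B).submatrix id f).det := by
    rw [hpencil, ← coe_evalRingHom, RingHom.map_det]
    congr 1
    ext i k
    simp [mul_comm t]
  have hp : p ≠ 0 := by
    intro h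
    have := heval t₀
    simp [h, hP] at this
  have hdeg : p.natDegree ≤ Fintype.card ι - 1 := by
    have hle : p.natDegree ≤ Fintype.card κ := natDegree_det_X_add_C_le B' A'
    have hκ : Fintype.card κ ≤ Fintype.card ι := Fintype.card_le_of_injective f hf
    rcases hκ.lt_or_eq with h | h
    · omega
    · obtain ⟨k, hk⟩ := ((Fintype.bijective_iff_injective_and_card f).2 ⟨hf, h⟩).2 j
      have hdet : B'.det = 0 := by
        refine det_eq_zero_of_column_eq_zero k fun i => ?_
        simp [hB', Matrix.mul_apply, hk, hB]
      have hcoeff : p.coeff (Fintype.card κ) = 0 :=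
        (coeff_det_X_add_C_card B' A').trans hdet
      have hne : p.natDegree ≠ Fintype.card κ := fun h' =>
        hp (leadingCoeff_eq_zero.1 (by rw [leadingCoeff, h', hcoeff]))
      omega
  refine ⟨p.roots.toFinset, ?_, fun t ht => ?_⟩
  · exact (Multiset.toFinset_card_le _).trans ((card_roots' p).trans hdeg)
  · rw [Multiset.mem_toFinset, mem_roots hp, IsRoot, heval]
    by_contra hdet
    have h1 := rank_of_det_ne_zero hdet
    have h2 := (rank_mul_le_right P ((A + t • B).submatrix id f)).trans
      (rank_submatrix_le (A + t • B) id f)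
    omega

section AdjCoeff

variable {R ι : Type*} [CommRing R] [Fintype ι] [DecidableEq ι]

/-- The coefficient of `X ^ k` in the adjugate of the characteristic matrix `X - L`. -/
noncomputable def adjCoeff (L : Matrix ι ι R) (k : ℕ) : Matrix ι ι R :=
  (matPolyEquiv (adjugate (charmatrix L))).coeff k

theorem adjCoeff_apply (L : Matrix ι ι R) (k : ℕ) (i j : ι) :
    adjCoeff L k i j = (adjugate (charmatrix L) i j).coeff k :=
  matPolyEquiv_coeff_apply _ _ _ _

theorem X_sub_C_mul_matPolyEquiv_adjugate (L : Matrix ι ι R) :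
    (Polynomial.X - Polynomial.C L) * matPolyEquiv (adjugate (charmatrix L)) =
      L.charpoly.map (algebraMap R (Matrix ι ι R)) := by
  rw [← matPolyEquiv_charmatrix, ← map_mul, mul_adjugate, ← matPolyEquiv_smul_one, charpoly]

/-- The Faddeev–LeVerrier recursion. -/
theorem adjCoeff_eq (L : Matrix ι ι R) (k : ℕ) :
    adjCoeff L k = L * adjCoeff L (k + 1) + L.charpoly.coeff (k + 1) • 1 := by
  have h := congrArg (Polynomial.coeff · (k + 1)) (X_sub_C_mul_matPolyEquiv_adjugate L)
  simp only [sub_mul, Polynomial.coeff_sub, Polynomial.coeff_X_mul, Polynomial.coeff_C_mul,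
    Polynomial.coeff_map, Algebra.algebraMap_eq_smul_one] at h
  rw [← h, adjCoeff, adjCoeff]
  abel

theorem mul_adjCoeff_zero (L : Matrix ι ι R) :
    L * adjCoeff L 0 = -(L.charpoly.coeff 0 • 1) := by
  have h := congrArg (Polynomial.coeff · 0) (X_sub_C_mul_matPolyEquiv_adjugate L)
  simp only [sub_mul, Polynomial.coeff_sub, Polynomial.coeff_X_mul_zero, Polynomial.coeff_C_mul,
    Polynomial.coeff_map, Algebra.algebraMap_eq_smul_one] at h
  rw [← h, adjCoeff]
  abel

theorem adjCoeff_eq_zero [Nontrivial R] (L : Matrix ι ι R) {k : ℕ} (hk : Fintype.card ι ≤ k) :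
    adjCoeff L k = 0 := by
  by_cases hlarge : (matPolyEquiv (adjugate (charmatrix L))).natDegree < k
  · exact Polynomial.coeff_eq_zero_of_natDegree_lt hlarge
  · rw [adjCoeff_eq, adjCoeff_eq_zero L (k := k + 1) (by omega),
      Polynomial.coeff_eq_zero_of_natDegree_lt (by rw [charpoly_natDegree_eq_dim]; omega)]
    simp
termination_by (matPolyEquiv (adjugate (charmatrix L))).natDegree + 1 - k

theorem adjCoeff_card_sub_one [Nontrivial R] [Nonempty ι] (L : Matrix ι ι R) :
    adjCoeff L (Fintype.card ι - 1) = 1 := by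
  have h : Fintype.card ι - 1 + 1 = Fintype.card ι :=
    Nat.sub_add_cancel Fintype.card_pos
  have hc : L.charpoly.coeff (Fintype.card ι) = 1 := by
    rw [← charpoly_natDegree_eq_dim L]
    exact L.charpoly_monic
  rw [adjCoeff_eq, h, adjCoeff_eq_zero L le_rfl, hc]
  simp

/-- Replacing a row of `A` by its sum with `c • v` changes the adjugate affinely in `c`. -/
theorem adjugate_updateRow_add_smul (A : Matrix ι ι R) (b : ι) (v : ι → R) (c : R) (i j : ι) :
    adjugate (A.updateRow b (A b + c • v)) i j =
      adjugate A i j + c * if j = b then 0 else adjugate (A.updateRow b v) i j := by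
  simp only [adjugate_apply]
  split_ifs with h
  · subst h
    simp
  · rw [updateRow_comm _ (Ne.symm h), det_updateRow_add, det_updateRow_smul,
      updateRow_comm A (Ne.symm h)]
    congr 2
    conv_rhs => rw [← updateRow_eq_self (A.updateRow j (Pi.single i 1)) b]
    rw [updateRow_ne (Ne.symm h)]

theorem exists_adjCoeff_updateRow (L : Matrix ι ι R) (b : ι) (v : ι → R) :
    ∃ E : ℕ → Matrix ι ι R, ∀ (c : R) (k : ℕ),
      adjCoeff (L.updateRow b (L b + c • v)) k = adjCoeff L k + c • E k := by
  let N := (charmatrix L).updateRow b fun i => -Polynomial.C (v i)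
  refine ⟨fun k => Matrix.of fun i j => if j = b then 0 else (adjugate N i j).coeff k,
    fun c k => ?_⟩
  have h : charmatrix (L.updateRow b (L b + c • v)) = (charmatrix L).updateRow b
      (charmatrix L b + Polynomial.C c • fun i => -Polynomial.C (v i)) := by
    ext1 i j
    by_cases hi : i = b
    · subst hi
      simp [charmatrix_apply]
      ring
    · simp [charmatrix_apply, hi]
  ext i j
  rw [Matrix.add_apply, Matrix.smul_apply, adjCoeff_apply, adjCoeff_apply, h,
    adjugate_updateRow_add_smul, Polynomial.coeff_add, Polynomial.coeff_C_mul]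
  simp only [of_apply, smul_eq_mul]
  split_ifs <;> simp [N]

end AdjCoeff

/-- The vectors `adjCoeff L k *ᵥ b` span the same space as the columns of the controllability
matrix. -/
theorem rank_ctrbMat {n : ℕ} (L : Matrix (Fin n) (Fin n) ℝ) (b : Fin n → ℝ) :
    (ctrbMat L b).rank =
      (Matrix.of fun i (k : Fin n) => (adjCoeff L k *ᵥ b) i : Matrix (Fin n) (Fin n) ℝ).rank := by
  rw [rank_eq_finrank_span_cols, rank_eq_finrank_span_cols]
  suffices h : Submodule.span ℝ (Set.range (ctrbMat L b).col) = Submodule.span ℝ (Set.range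
      (Matrix.of fun i (k : Fin n) => (adjCoeff L k *ᵥ b) i : Matrix (Fin n) (Fin n) ℝ).col) by
    rw [h]
  rcases Nat.eq_zero_or_pos n with rfl | hn
  · exact Subsingleton.elim _ _
  have : Nonempty (Fin n) := ⟨⟨0, hn⟩⟩
  set S := Submodule.span ℝ (Set.range (ctrbMat L b).col)
  set T := Submodule.span ℝ (Set.range
    (Matrix.of fun i (k : Fin n) => (adjCoeff L k *ᵥ b) i : Matrix (Fin n) (Fin n) ℝ).col)
  have hS (k : ℕ) (hk : k < n) : (L ^ k) *ᵥ b ∈ S :=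
    Submodule.subset_span ⟨⟨k, hk⟩, rfl⟩
  have hT (k : ℕ) : adjCoeff L k *ᵥ b ∈ T := by
    by_cases hk : k < n
    · exact Submodule.subset_span ⟨⟨k, hk⟩, rfl⟩
    · rw [adjCoeff_eq_zero L (by simpa using hk), zero_mulVec]
      exact T.zero_mem
  have hbT : b ∈ T := by
    have h := hT (Fintype.card (Fin n) - 1)
    rwa [adjCoeff_card_sub_one, one_mulVec] at h
  apply le_antisymm
  · have hL : T ≤ T.comap L.mulVecLin := by
      refine Submodule.span_le.2 ?_
      rintro _ ⟨⟨k, hk⟩, rfl⟩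
      change L *ᵥ (adjCoeff L k *ᵥ b) ∈ T
      rw [mulVec_mulVec]
      cases k with
      | zero =>
        rw [mul_adjCoeff_zero, neg_mulVec, smul_mulVec, one_mulVec]
        exact T.neg_mem (T.smul_mem _ hbT)
      | succ k =>
        rw [eq_sub_of_add_eq (adjCoeff_eq L k).symm, sub_mulVec, smul_mulVec, one_mulVec]
        exact T.sub_mem (hT k) (T.smul_mem _ hbT)
    refine Submodule.span_le.2 ?_
    rintro _ ⟨⟨k, hk⟩, rfl⟩
    change (L ^ k) *ᵥ b ∈ T
    clear hk
    induction k with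
    | zero => simpa using hbT
    | succ k ih =>
      rw [pow_succ', ← mulVec_mulVec]
      exact hL ih
  · have hD (m : ℕ) : ∀ l, m + l ≤ n → (L ^ l * adjCoeff L (n - m)) *ᵥ b ∈ S := by
      induction m with
      | zero =>
        intro l _
        rw [adjCoeff_eq_zero L (by simp), mul_zero, zero_mulVec]
        exact S.zero_mem
      | succ m ih =>
        intro l hl
        have h : n - (m + 1) + 1 = n - m := by omega
        rw [adjCoeff_eq, h, mul_add, ← mul_assoc, ← pow_succ, mul_smul_comm, mul_one,
          add_mulVec, smul_mulVec]
        exact S.add_mem (ih _ (by omega)) (S.smul_mem _ (hS _ (by omega)))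
    refine Submodule.span_le.2 ?_
    rintro _ ⟨⟨k, hk⟩, rfl⟩
    change adjCoeff L k *ᵥ b ∈ S
    have h := hD (n - k) 0 (by omega)
    rwa [pow_zero, one_mul, Nat.sub_sub_self hk.le] at h

/-- Increasing the weight of the edge `(a, b)` changes only row `b` of the Laplacian. -/
theorem lapOf_weight_increment {n : ℕ} (Adj : Fin n → Fin n → Prop) [DecidableRel Adj]
    (w : Fin n → Fin n → ℝ) {a b : Fin n} (hne : a ≠ b) (hab : Adj a b) (ε : ℝ) :
    lapOf Adj (fun x y => if (x, y) = (a, b) then w a b + ε else w x y) =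
      (lapOf Adj w).updateRow b
        (lapOf Adj w b + ε • (Pi.single b 1 - Pi.single a 1 : Fin n → ℝ)) := by
  ext i j
  by_cases hi : i = b
  · subst hi
    by_cases hj : j = i
    · subst hj
      have h (m : Fin n) : (if Adj m j then if m = a then w a j + ε else w m j else 0) =
          (if Adj m j then w m j else 0) + if m = a then ε else 0 := by
        by_cases hm : m = a
        · subst hm
          simp [hab]
        · simp [hm]
      simp [lapOf, h, Finset.sum_add_distrib, hne.symm]
    · by_cases hja : j = a
      · subst hja
        simp [lapOf, hab, hne, hne.symm]
        ring
      · simp [lapOf, hj, hja, Ne.symm hj]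
  · simp [lapOf, hi]

/-- **Almost every weight increment improves controllability.**
Fix an edge `(a, b)` of the weighted directed graph and, for `ε > 0`, let `L_ε` be the
Laplacian obtained by increasing the weight of `(a, b)` by `ε`.  If some `ε₀ > 0` makes the
rank of the controllability matrix of `(L_{ε₀}, e_0)` exceed that of `(L, e_0)`, then the
set of `ε > 0` failing to do so is finite, with at most `n − 1` elements (the roots of a
nonzero polynomial of degree at most `n − 1` in `ε`). -/
theorem weight_increment_generic {n : ℕ} (hn : 0 < n)
    (Adj : Fin n → Fin n → Prop) [DecidableRel Adj]
    (hloop : ∀ u, ¬ Adj u u)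
    (w : Fin n → Fin n → ℝ) (hw : ∀ a b, Adj a b → 0 < w a b)
    (a b : Fin n) (hab : Adj a b)
    (hexists : ∃ ε₀ : ℝ, 0 < ε₀ ∧
      (ctrbMat (lapOf Adj (fun x y => if (x, y) = (a, b) then w a b + ε₀ else w x y))
          (Pi.single (⟨0, hn⟩ : Fin n) 1)).rank >
        (ctrbMat (lapOf Adj w) (Pi.single (⟨0, hn⟩ : Fin n) 1)).rank) :
    ∃ s : Finset ℝ, s.card ≤ n - 1 ∧
      ∀ ε : ℝ, 0 < ε →
        (ctrbMat (lapOf Adj (fun x y => if (x, y) = (a, b) then w a b + ε else w x y))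
            (Pi.single (⟨0, hn⟩ : Fin n) 1)).rank ≤
          (ctrbMat (lapOf Adj w) (Pi.single (⟨0, hn⟩ : Fin n) 1)).rank →
        ε ∈ s := by
  have hne : a ≠ b := fun h => hloop b (h ▸ hab)
  have : Nonempty (Fin n) := ⟨⟨0, hn⟩⟩
  obtain ⟨ε₀, -, hε₀⟩ := hexists
  set e : Fin n → ℝ := Pi.single (⟨0, hn⟩ : Fin n) 1
  obtain ⟨E, hE⟩ := exists_adjCoeff_updateRow (lapOf Adj w) b (Pi.single b 1 - Pi.single a 1)
  have hrank (ε : ℝ) :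
      (ctrbMat (lapOf Adj (fun x y => if (x, y) = (a, b) then w a b + ε else w x y)) e).rank =
        ((Matrix.of fun i (k : Fin n) => (adjCoeff (lapOf Adj w) k *ᵥ e) i) +
          ε • (Matrix.of fun i (k : Fin n) => (E k *ᵥ e) i) : Matrix (Fin n) (Fin n) ℝ).rank := by
    rw [lapOf_weight_increment Adj w hne hab, rank_ctrbMat]
    congr 1
    ext i k
    simp [hE, add_mulVec, smul_mulVec]
  have hlast : E (n - 1) = 0 := by
    have h := hE 1 (Fintype.card (Fin n) - 1)
    rw [adjCoeff_card_sub_one, adjCoeff_card_sub_one, one_smul] at h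
    simpa using h
  obtain ⟨s, hs, hmem⟩ := exists_finset_rank_lt_pencil
    (Matrix.of fun i (k : Fin n) => (adjCoeff (lapOf Adj w) k *ᵥ e) i)
    (Matrix.of fun i (k : Fin n) => (E k *ᵥ e) i) (⟨n - 1, by omega⟩ : Fin n)
    (fun i => by simp [hlast]) ε₀
  refine ⟨s, by simpa using hs, fun ε _ hε => hmem ε ?_⟩
  rw [← hrank, ← hrank]
  exact hε.trans_lt hε₀
end

section
/- Let A ∈ ℝ^{n×n} be the adjacency matrix of an in-degree regular directed graph with common in-degree d, and let L = dI − A. Then the pair (L, e_1) is controllable (the graph can be controlled by agent 1 as single leader) if and only if the matrix M ∈ ℝ^{(n−1)×(n−1)} with entries M_{ij} = (A^j)_{i+1, 1} for 1 ≤ i, j ≤ n−1 (M_{ij} is the number of directed walks of length j from vertex 1 to vertex i+1) is invertible. -/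
open Matrix

open Polynomial in
/-- Affine changes `L ↦ c • 1 - L` of the system matrix change the controllability matrix by a
triangular factor whose columns are the coefficients of the powers of `c - X`. -/
lemma ctrbMat_smul_one_sub {n : ℕ} (A : Matrix (Fin n) (Fin n) ℝ) (c : ℝ) (b : Fin n → ℝ) :
    ctrbMat (c • (1 : Matrix (Fin n) (Fin n) ℝ) - A) b =
      ctrbMat A b * Matrix.of fun j k : Fin n => ((C c - X : ℝ[X]) ^ (k : ℕ)).coeff j := by
  ext i k
  have hdeg : ((C c - X : ℝ[X]) ^ (k : ℕ)).natDegree < n := by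
    refine lt_of_le_of_lt natDegree_pow_le ?_
    have h : (C c - X : ℝ[X]).natDegree ≤ 1 := by compute_degree
    exact lt_of_le_of_lt (by simpa using Nat.mul_le_mul_left (k : ℕ) h) k.isLt
  have hpow : (c • (1 : Matrix (Fin n) (Fin n) ℝ) - A) ^ (k : ℕ) =
      ∑ j : Fin n, ((C c - X : ℝ[X]) ^ (k : ℕ)).coeff j • A ^ (j : ℕ) := by
    rw [Fin.sum_univ_eq_sum_range (fun j => ((C c - X : ℝ[X]) ^ (k : ℕ)).coeff j • A ^ j) n,
      ← aeval_eq_sum_range' hdeg A]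
    simp [Algebra.algebraMap_eq_smul_one]
  simp only [ctrbMat, Matrix.of_apply, Matrix.mul_apply, hpow, Matrix.sum_mulVec,
    Finset.sum_apply, Matrix.smul_mulVec, Pi.smul_apply, smul_eq_mul]
  exact Finset.sum_congr rfl fun j _ => mul_comm _ _

open Polynomial in
lemma isUnit_det_coeff_pow_C_sub_X (n : ℕ) (c : ℝ) :
    IsUnit (Matrix.of fun j k : Fin n => ((C c - X : ℝ[X]) ^ (k : ℕ)).coeff j).det := by
  have h : (C c - X : ℝ[X]).natDegree ≤ 1 := by compute_degree
  rw [Matrix.det_of_isUpperTriangular]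
  · rw [isUnit_iff_ne_zero, Finset.prod_ne_zero_iff]
    intro k _
    have := coeff_pow_of_natDegree_le (m := (k : ℕ)) h
    rw [mul_one] at this
    simp [this]
  · intro i j hij
    refine coeff_eq_zero_of_natDegree_lt (lt_of_le_of_lt natDegree_pow_le ?_)
    exact lt_of_le_of_lt (by simpa using Nat.mul_le_mul_left (j : ℕ) h) hij

/-- The first column of `ctrbMat A e₀` is `e₀`, so its determinant is that of the
complementary block. -/
lemma det_ctrbMat_single_zero {n : ℕ} (A : Matrix (Fin (n + 1)) (Fin (n + 1)) ℝ) :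
    (ctrbMat A (Pi.single (0 : Fin (n + 1)) 1)).det =
      (Matrix.of fun i j : Fin n => (A ^ ((j : ℕ) + 1)) i.succ (0 : Fin (n + 1))).det := by
  rw [Matrix.det_succ_column_zero, Fin.sum_univ_succ]
  simp only [ctrbMat, Matrix.of_apply, Fin.val_zero, pow_zero, Matrix.one_mulVec,
    Pi.single_eq_same, Pi.single_eq_of_ne (Fin.succ_ne_zero _), mul_zero, zero_mul,
    Finset.sum_const_zero, add_zero, one_mul]
  congr 1
  ext i j
  simp

lemma rank_eq_iff_isUnit_det {n : ℕ} (A : Matrix (Fin n) (Fin n) ℝ) :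
    A.rank = n ↔ IsUnit A.det := by
  rw [← Matrix.isUnit_iff_isUnit_det]
  refine ⟨fun h => ?_, fun h => by simpa using Matrix.rank_of_isUnit A h⟩
  rw [← Matrix.mulVec_surjective_iff_isUnit]
  have : LinearMap.range A.mulVecLin = ⊤ :=
    Submodule.eq_top_of_finrank_eq (by simpa [Matrix.rank] using h)
  exact LinearMap.range_eq_top.mp this

/-- **Controllability of in-degree regular graphs.**
Let `A` be the adjacency matrix of an in-degree regular directed graph on `n + 1` vertices
(`A i j = 1` iff there is an edge from `j` to `i`; zero diagonal; each row sums to the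
common in-degree `d`) and let `L = d•I − A` be its Laplacian.  Then the pair `(L, e_0)`
is controllable (agent `0`, i.e. agent "1", is a single leader) iff the matrix
`M : ℝ^{n×n}` with `M i j = (A^{j+1})_{i+1, 0}` (the number of directed walks of length
`j + 1` from vertex `0` to vertex `i + 1`) is invertible. -/
theorem indegree_regular_controllable_iff {n : ℕ}
    (A : Matrix (Fin (n + 1)) (Fin (n + 1)) ℝ) (d : ℝ)
    (h01 : ∀ i j, A i j = 0 ∨ A i j = 1)
    (hdiag : ∀ i, A i i = 0)
    (hreg : ∀ i, ∑ j, A i j = d) :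
    (ctrbMat (d • (1 : Matrix (Fin (n + 1)) (Fin (n + 1)) ℝ) - A)
        (Pi.single (0 : Fin (n + 1)) 1)).rank = n + 1 ↔
      IsUnit (Matrix.of fun i j : Fin n =>
        (A ^ ((j : ℕ) + 1)) i.succ (0 : Fin (n + 1))).det := by
  rw [rank_eq_iff_isUnit_det, ctrbMat_smul_one_sub, Matrix.det_mul, IsUnit.mul_iff,
    det_ctrbMat_single_zero]
  exact and_iff_left (isUnit_det_coeff_pow_C_sub_X (n + 1) d)
end

section
/- Let A ∈ ℝ^{n×n} be the adjacency matrix of an in-degree regular directed graph with common in-degree d, and set S = Σ_{k=1}^{n−1} A^k. If for every column index j ∈ {1,…,n} there exists some i ≠ j with S_{ij} = 0, then the system is not single-leader controllable: for every j ∈ {1,…,n}, the pair (dI − A, e_j) is not controllable. -/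
open Matrix

namespace Matrix

/-- If the `(i, j)` entry of `A ^ m` vanishes for all `m ≤ N`, then so does that of
`A ^ m * (d • 1 - A) ^ k` whenever `m + k ≤ N`. -/
lemma pow_mul_smul_one_sub_pow_apply_eq_zero {R ι : Type*} [CommRing R] [Fintype ι]
    [DecidableEq ι] {A : Matrix ι ι R} {i j : ι} {N : ℕ} (d : R)
    (h : ∀ m ≤ N, (A ^ m) i j = 0) (k m : ℕ) (hmk : m + k ≤ N) :
    (A ^ m * (d • (1 : Matrix ι ι R) - A) ^ k) i j = 0 := by
  induction k generalizing m with
  | zero => simpa using h m hmk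
  | succ k ih =>
    have hL : A ^ m * (d • (1 : Matrix ι ι R) - A) ^ (k + 1) =
        d • (A ^ m * (d • 1 - A) ^ k) - A ^ (m + 1) * (d • 1 - A) ^ k := by
      rw [pow_succ' (d • 1 - A), sub_mul, mul_sub, smul_mul_assoc, one_mul, mul_smul_comm,
        pow_succ A, mul_assoc (A ^ m) A]
    rw [hL, sub_apply, smul_apply, ih m (by omega), ih (m + 1) (by omega), smul_zero, sub_zero]

/-- A square matrix over a field with a zero row does not have full rank. -/
lemma rank_ne_card_of_row_eq_zero {K ι : Type*} [Field K] [Fintype ι]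
    {M : Matrix ι ι K} (i : ι) (h : ∀ j, M i j = 0) : M.rank ≠ Fintype.card ι := by
  intro hr
  have hli : LinearIndependent K M.row := by
    rw [linearIndependent_iff_card_eq_finrank_span, ← hr, rank_eq_finrank_span_row]
    rfl
  exact hli.ne_zero i (funext h)

end Matrix

/-- Let `A` be the adjacency matrix of an in-degree regular directed graph on `n` vertices
(`A i j = 1` iff there is an edge from `j` to `i`; zero diagonal; row sums equal to the
common in-degree `d`), and let `S = A + A² + ⋯ + A^{n−1}`.  If every column `j` of `S` has
a zero entry off the diagonal (some `i ≠ j` with `S i j = 0`), then the system is not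
single-leader controllable: for every `j`, the pair `(dI − A, e_j)` is not controllable. -/
theorem indegree_regular_not_SLC {n : ℕ}
    (A : Matrix (Fin n) (Fin n) ℝ) (d : ℝ)
    (h01 : ∀ i j, A i j = 0 ∨ A i j = 1)
    (hdiag : ∀ i, A i i = 0)
    (hreg : ∀ i, ∑ j, A i j = d)
    (hzero : ∀ j : Fin n, ∃ i : Fin n, i ≠ j ∧
      (∑ k ∈ Finset.Icc 1 (n - 1), A ^ k) i j = 0) :
    ∀ j : Fin n,
      ¬ (ctrbMat (d • (1 : Matrix (Fin n) (Fin n) ℝ) - A) (Pi.single j 1)).rank = n := by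
  intro j hr
  obtain ⟨i, hij, hS⟩ := hzero j
  have hA : ∀ i j, 0 ≤ A i j := fun i j => by
    rcases h01 i j with h | h <;> rw [h]
    exact zero_le_one
  have hpow : ∀ m ≤ n - 1, (A ^ m) i j = 0 := by
    intro m hm
    rcases Nat.eq_zero_or_pos m with rfl | hpos
    · rw [pow_zero, Matrix.one_apply_ne hij]
    · rw [Matrix.sum_apply,
        Finset.sum_eq_zero_iff_of_nonneg fun k _ => Matrix.pow_apply_nonneg hA k i j] at hS
      exact hS m (Finset.mem_Icc.mpr ⟨hpos, hm⟩)
  refine Matrix.rank_ne_card_of_row_eq_zero i (fun k => ?_) (hr.trans (Fintype.card_fin n).symm)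
  have hk := Matrix.pow_mul_smul_one_sub_pow_apply_eq_zero d hpow k 0 (by omega)
  rw [pow_zero, one_mul] at hk
  simpa [ctrbMat] using hk
end

section
/- Let A ∈ ℝ^{n×n} be the adjacency matrix of an in-degree regular directed graph with common in-degree d, set S = Σ_{k=1}^{n−1} A^k, and let V_l ⊆ {1,…,n} be a leader set. If the pair (dI − A, B_{V_l}) is controllable, where B_{V_l} is the matrix whose columns are the standard basis vectors e_j for j ∈ V_l, then for every i ∉ V_l there exists j ∈ V_l with S_{ij} ≠ 0. Consequently, if m is the minimum cardinality of a set T ⊆ {1,…,n} such that for every i ∉ T there exists j ∈ T with S_{ij} ≠ 0, then any leader set making the system controllable satisfies |V_l| ≥ m. -/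
open Matrix

theorem Matrix.rank_lt_card_of_row_eq_zero {m n R : Type*} [Fintype m] [Fintype n] [Field R]
    (M : Matrix m n R) (i : m) (hi : M.row i = 0) : M.rank < Fintype.card m := by
  refine lt_of_le_of_ne M.rank_le_card_height fun h => ?_
  rw [M.rank_eq_finrank_span_row] at h
  exact (linearIndependent_iff_card_eq_finrank_span.mpr h.symm).ne_zero i hi

theorem Matrix.pow_mul_smul_one_sub_pow_apply_eq_zero_s15 {ι R : Type*} [Fintype ι] [DecidableEq ι]
    [CommRing R] (A : Matrix ι ι R) (d : R) {i j : ι} {N : ℕ}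
    (h : ∀ l ≤ N, (A ^ l) i j = 0) (k l : ℕ) (hkl : l + k ≤ N) :
    (A ^ l * (d • (1 : Matrix ι ι R) - A) ^ k) i j = 0 := by
  induction k generalizing l with
  | zero => simpa using h l hkl
  | succ k ih =>
    have e : A ^ l * (d • (1 : Matrix ι ι R) - A) ^ (k + 1) =
        d • (A ^ l * (d • (1 : Matrix ι ι R) - A) ^ k) -
          A ^ (l + 1) * (d • (1 : Matrix ι ι R) - A) ^ k := by
      rw [pow_succ' _ k, ← mul_assoc, mul_sub, sub_mul, mul_smul_comm, mul_one, smul_mul_assoc,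
        ← pow_succ]
    rw [e, Matrix.sub_apply, Matrix.smul_apply, ih l (by lia), ih (l + 1) (by lia)]
    simp

/-- Let `A` be the adjacency matrix of an in-degree regular directed graph on `n` vertices
(`A i j = 1` iff there is an edge from `j` to `i`; zero diagonal; row sums equal to the
common in-degree `d`), let `S = A + A² + ⋯ + A^{n−1}` and let `V_l` be a leader set.  If
`(dI − A, B_{V_l})` is controllable, then every `i ∉ V_l` satisfies `S i j ≠ 0` for some
`j ∈ V_l`.  Consequently, if `m` is the minimum cardinality of a set `T` with this
covering property, then every controlling leader set has at least `m` elements. -/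
theorem indegree_regular_leader_lower_bound {n : ℕ}
    (A : Matrix (Fin n) (Fin n) ℝ) (d : ℝ)
    (h01 : ∀ i j, A i j = 0 ∨ A i j = 1)
    (hdiag : ∀ i, A i i = 0)
    (hreg : ∀ i, ∑ j, A i j = d)
    (Vl : Finset (Fin n))
    (hctrb : (ctrbMatSet (d • (1 : Matrix (Fin n) (Fin n) ℝ) - A) Vl).rank = n) :
    (∀ i : Fin n, i ∉ Vl → ∃ j ∈ Vl, (∑ k ∈ Finset.Icc 1 (n - 1), A ^ k) i j ≠ 0) ∧
    (∀ m : ℕ,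
      IsLeast {c : ℕ | ∃ T : Finset (Fin n), T.card = c ∧
        ∀ i : Fin n, i ∉ T → ∃ j ∈ T, (∑ k ∈ Finset.Icc 1 (n - 1), A ^ k) i j ≠ 0} m →
      m ≤ Vl.card) := by
  have hcover : ∀ i : Fin n, i ∉ Vl →
      ∃ j ∈ Vl, (∑ k ∈ Finset.Icc 1 (n - 1), A ^ k) i j ≠ 0 := by
    intro i hi
    by_contra! hS
    have hA : ∀ i j, 0 ≤ A i j := fun i j => by rcases h01 i j with h | h <;> simp [h]
    have hpow : ∀ j ∈ Vl, ∀ l ≤ n - 1, (A ^ l) i j = 0 := by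
      intro j hj l hl
      rcases Nat.eq_zero_or_pos l with rfl | hl0
      · rw [pow_zero, Matrix.one_apply_ne (ne_of_mem_of_not_mem hj hi).symm]
      · have hsum := hS j hj
        rw [Matrix.sum_apply, Finset.sum_eq_zero_iff_of_nonneg
          fun k _ => Matrix.pow_apply_nonneg hA k i j] at hsum
        exact hsum l (Finset.mem_Icc.mpr ⟨hl0, hl⟩)
    refine (Matrix.rank_lt_card_of_row_eq_zero _ i ?_).ne (hctrb.trans (Fintype.card_fin n).symm)
    ext ⟨k, j, hj⟩
    have := Matrix.pow_mul_smul_one_sub_pow_apply_eq_zero_s15 A d (hpow j hj) k 0 (by lia)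
    simpa [ctrbMatSet] using this
  exact ⟨hcover, fun m hm => hm.2 ⟨Vl, rfl, hcover⟩⟩
end

section
/- Let A ∈ ℝ^{n×n} be the adjacency matrix of an in-degree regular directed graph G with common in-degree d, and set S = Σ_{k=1}^{n−1} A^k. Then G is structurally controllable with a single leader — i.e., there exist a vertex v and positive weights on the edges of G (the positions (j→i) with A_{ij} = 1) such that the resulting weighted Laplacian L_w makes the pair (L_w, e_v) controllable — if and only if there exists a column index j such that S_{ij} ≠ 0 for every i ≠ j (the j-th column of S contains no 0 entry except possibly the diagonal entry). -/
open Matrix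

/-- The weighted Laplacian of the directed graph with 0-1 adjacency matrix `A`
(`A i j = 1` iff there is an edge `j → i`) and positive weights `ω i j` on the edges
`j → i`. -/
noncomputable def lapOfAdjMat {n : ℕ} (A : Matrix (Fin n) (Fin n) ℝ)
    (ω : Fin n → Fin n → ℝ) : Matrix (Fin n) (Fin n) ℝ :=
  Matrix.of fun i j =>
    if i = j then ∑ m, (if A i m = 1 then ω i m else 0)
    else -(if A i j = 1 then ω i j else 0)

/-- If the controllability matrix has full rank, every coordinate is reached by some power. -/
lemma exists_pow_apply_ne_zero_of_rank_ctrbMat {n : ℕ} (L : Matrix (Fin n) (Fin n) ℝ) (v : Fin n)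
    (h : (ctrbMat L (Pi.single v 1)).rank = n) (i : Fin n) :
    ∃ k < n, (L ^ k) i v ≠ 0 := by
  by_contra! hzero
  have htop : LinearMap.range (ctrbMat L (Pi.single v 1)).mulVecLin = ⊤ := by
    apply Submodule.eq_top_of_finrank_eq
    rw [← Matrix.rank, h, Module.finrank_fin_fun]
  obtain ⟨u, hu⟩ := LinearMap.range_eq_top.mp htop (Pi.single i 1)
  have hi := congrFun hu i
  have hrow : ∀ k, ctrbMat L (Pi.single v 1) i k = 0 := fun k => by
    simpa [ctrbMat] using hzero k k.isLt
  simp [Matrix.mulVec, dotProduct, hrow] at hi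

/-- If the off-diagonal support of `L` lies in that of the nonnegative matrix `A`, then a nonzero
entry of `L ^ k` comes from a walk of length at most `k` in the graph of `A`. -/
lemma Matrix.exists_pow_pos_of_pow_apply_ne_zero {n : ℕ} {A L : Matrix (Fin n) (Fin n) ℝ}
    (hA : ∀ i j, 0 ≤ A i j) (hL : ∀ i j, i ≠ j → L i j ≠ 0 → A i j ≠ 0) (v : Fin n) (k : ℕ)
    (i : Fin n) (h : (L ^ k) i v ≠ 0) : ∃ m ≤ k, 0 < (A ^ m) i v := by
  induction k generalizing i with
  | zero =>
    refine ⟨0, le_rfl, ?_⟩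
    rw [pow_zero, Matrix.one_apply] at h ⊢
    split_ifs at h ⊢ with hiv
    · exact one_pos
    · exact absurd rfl h
  | succ k ih =>
    rw [pow_succ', Matrix.mul_apply] at h
    obtain ⟨j, -, hj⟩ := Finset.exists_ne_zero_of_sum_ne_zero h
    obtain ⟨m, hm, hpos⟩ := ih j (right_ne_zero_of_mul hj)
    by_cases hij : i = j
    · subst hij
      exact ⟨m, by omega, hpos⟩
    · refine ⟨m + 1, by omega, ?_⟩
      have hAij : 0 < A i j := lt_of_le_of_ne (hA i j) (hL i j hij (left_ne_zero_of_mul hj)).symm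
      rw [pow_succ', Matrix.mul_apply]
      exact Finset.sum_pos' (fun l _ => mul_nonneg (hA i l) (pow_apply_nonneg hA m l v))
        ⟨j, Finset.mem_univ j, mul_pos hAij hpos⟩

/-- If every vertex is reached from `v`, then there is a spanning tree rooted at `v`, given by
a parent map `p` along which the depth `r` decreases. -/
lemma Matrix.exists_parent {n : ℕ} (A : Matrix (Fin n) (Fin n) ℝ) (v : Fin n)
    (h : ∀ i, ∃ k : ℕ, (A ^ k) i v ≠ 0) :
    ∃ (r : Fin n → ℕ) (p : Fin n → Fin n), ∀ i, i ≠ v → A i (p i) ≠ 0 ∧ r (p i) < r i := by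
  classical
  have key : ∀ i, ∃ j, i ≠ v → A i j ≠ 0 ∧ Nat.find (h j) < Nat.find (h i) := by
    intro i
    by_cases hi : i = v
    · exact ⟨i, fun h => absurd hi h⟩
    have hs := Nat.find_spec (h i)
    obtain ⟨k, hk⟩ : ∃ k, Nat.find (h i) = k + 1 := by
      refine Nat.exists_eq_succ_of_ne_zero fun h0 => ?_
      rw [h0, pow_zero, Matrix.one_apply_ne hi] at hs
      exact hs rfl
    rw [hk, pow_succ', Matrix.mul_apply] at hs
    obtain ⟨j, -, hj⟩ := Finset.exists_ne_zero_of_sum_ne_zero hs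
    refine ⟨j, fun _ => ⟨left_ne_zero_of_mul hj, ?_⟩⟩
    have := Nat.find_min' (h j) (right_ne_zero_of_mul hj)
    omega
  choose p hp using key
  exact ⟨fun i => Nat.find (h i), p, hp⟩

/-- A left eigenvector for each of `n` distinct eigenvalues, none of them orthogonal to `e_v`,
forces controllability of `(L, e_v)`. -/
lemma det_ctrbMat_ne_zero_of_left_eigenvectors {n : ℕ} (L : Matrix (Fin n) (Fin n) ℝ) (v : Fin n)
    (d : Fin n → ℝ) (hd : Function.Injective d)
    (h : ∀ k, ∃ x : Fin n → ℝ, x ᵥ* L = d k • x ∧ x v ≠ 0) :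
    (ctrbMat L (Pi.single v 1)).det ≠ 0 := by
  choose x hx hxv using h
  have hpow : ∀ k (m : ℕ), x k ᵥ* L ^ m = d k ^ m • x k := by
    intro k m
    induction m with
    | zero => simp
    | succ m ih => rw [pow_succ, ← Matrix.vecMul_vecMul, ih, Matrix.smul_vecMul, hx, smul_smul,
        pow_succ]
  have hmul : Matrix.of x * ctrbMat L (Pi.single v 1)
      = Matrix.diagonal (fun k => x k v) * Matrix.vandermonde d := by
    ext k m
    have h1 : (Matrix.of x * ctrbMat L (Pi.single v 1)) k m
        = x k ⬝ᵥ (L ^ (m : ℕ) *ᵥ Pi.single v 1) := rfl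
    rw [h1, Matrix.dotProduct_mulVec, hpow, Matrix.diagonal_mul, Matrix.vandermonde_apply]
    simp [mul_comm]
  have hdet := congrArg Matrix.det hmul
  rw [Matrix.det_mul, Matrix.det_mul, Matrix.det_diagonal] at hdet
  refine right_ne_zero_of_mul (a := (Matrix.of x).det) ?_
  rw [hdet]
  exact mul_ne_zero (Finset.prod_ne_zero_iff.mpr fun k _ => hxv k)
    (Matrix.det_vandermonde_ne_zero_iff.mpr hd)

/-- The Laplacian of a tree rooted at `v` with distinct positive edge weights is controllable
from `v`. -/
lemma det_ctrbMat_tree_ne_zero_s16 {n : ℕ} (L : Matrix (Fin n) (Fin n) ℝ) (v : Fin n)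
    (d : Fin n → ℝ) (hd : Function.Injective d) (hdv : d v = 0) (r : Fin n → ℕ)
    (p : Fin n → Fin n) (hr : ∀ i, i ≠ v → r (p i) < r i)
    (hLv : (Pi.single v 1 : Fin n → ℝ) ᵥ* L = 0)
    (hL : ∀ i, i ≠ v → (Pi.single i 1 : Fin n → ℝ) ᵥ* L
      = d i • (Pi.single i 1 - Pi.single (p i) 1)) :
    (ctrbMat L (Pi.single v 1)).det ≠ 0 := by
  have resolvent : ∀ (l : ℝ), l ≠ 0 → ∀ (m : ℕ) (j : Fin n), r j = m →
      (∀ i, r i ≤ m → d i ≠ l) →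
      ∃ R : Fin n → ℝ, R ᵥ* L = l • R + Pi.single j 1 ∧ R v ≠ 0 := by
    intro l hl m
    induction m using Nat.strong_induction_on with
    | _ m ih =>
      intro j hj hm
      by_cases hjv : j = v
      · subst hjv
        refine ⟨-l⁻¹ • Pi.single j 1, ?_, by simp [hl]⟩
        rw [Matrix.smul_vecMul, hLv, smul_smul]
        simp [hl]
      · have hlt := hr j hjv
        obtain ⟨R, hR, hRv⟩ := ih (r (p j)) (hj ▸ hlt) (p j) rfl
          fun i hi => hm i (by omega)
        have hne : d j - l ≠ 0 := sub_ne_zero.mpr (hm j hj.le)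
        have hdj : d j ≠ 0 := fun h0 => hjv (hd (h0.trans hdv.symm))
        refine ⟨(d j - l)⁻¹ • (Pi.single j 1 + d j • R), ?_, ?_⟩
        · rw [Matrix.smul_vecMul, Matrix.add_vecMul, Matrix.smul_vecMul, hL j hjv, hR]
          ext i
          simp only [Pi.smul_apply, Pi.add_apply, Pi.sub_apply, smul_eq_mul]
          field_simp
          ring
        · simp [Ne.symm hjv, hne, hdj, hRv]
  refine det_ctrbMat_ne_zero_of_left_eigenvectors L v d hd fun k => ?_
  by_cases hk : k = v
  · subst hk
    exact ⟨Pi.single k 1, by rw [hLv, hdv, zero_smul], by simp⟩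
  have hdk : d k ≠ 0 := fun h0 => hk (hd (h0.trans hdv.symm))
  obtain ⟨R, hR, hRv⟩ := resolvent (d k) hdk _ (p k) rfl fun i hi hik => by
    have := hr k hk
    rw [hd hik] at hi
    omega
  refine ⟨Pi.single k 1 + d k • R, ?_, by simp [Ne.symm hk, hdk, hRv]⟩
  rw [Matrix.add_vecMul, Matrix.smul_vecMul, hL k hk, hR]
  ext i
  simp only [Pi.smul_apply, Pi.add_apply, Pi.sub_apply, smul_eq_mul]
  ring

lemma continuous_det_ctrbMat {n : ℕ} (b : Fin n → ℝ) :
    Continuous fun L : Matrix (Fin n) (Fin n) ℝ => (ctrbMat L b).det := by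
  refine Continuous.matrix_det (continuous_matrix fun i k => ?_)
  simp only [ctrbMat, Matrix.of_apply]
  exact (continuous_apply i).comp ((continuous_id.pow (k : ℕ)).matrix_mulVec continuous_const)

lemma continuous_lapOfAdjMat {n : ℕ} (A : Matrix (Fin n) (Fin n) ℝ) :
    Continuous fun ω : Fin n → Fin n → ℝ => lapOfAdjMat A ω := by
  refine continuous_matrix fun i j => ?_
  simp only [lapOfAdjMat, Matrix.of_apply]
  split_ifs
  · refine continuous_finsetSum _ fun m _ => ?_
    split_ifs <;> fun_prop
  · fun_prop
  · fun_prop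

/-- Controllability with nonnegative weights persists for some positive weights. -/
lemma exists_pos_weights_of_nonneg {n : ℕ} (A : Matrix (Fin n) (Fin n) ℝ) (b : Fin n → ℝ)
    (ω : Fin n → Fin n → ℝ) (hω : ∀ i j, 0 ≤ ω i j)
    (h : (ctrbMat (lapOfAdjMat A ω) b).det ≠ 0) :
    ∃ ω' : Fin n → Fin n → ℝ, (∀ i j, 0 < ω' i j) ∧ (ctrbMat (lapOfAdjMat A ω') b).det ≠ 0 := by
  have hpert : Continuous fun ε : ℝ => (fun i j => ω i j + ε : Fin n → Fin n → ℝ) := by fun_prop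
  have hcont : Continuous fun ε : ℝ =>
      (ctrbMat (lapOfAdjMat A fun i j => ω i j + ε) b).det :=
    (continuous_det_ctrbMat b).comp ((continuous_lapOfAdjMat A).comp hpert)
  have hev := hcont.continuousAt.eventually_ne (x := 0) (y := 0) (by simpa using h)
  obtain ⟨ε, hε, hpos⟩ :=
    ((hev.filter_mono nhdsWithin_le_nhds).and (self_mem_nhdsWithin (s := Set.Ioi (0 : ℝ)))).exists
  exact ⟨_, fun i j => add_pos_of_nonneg_of_pos (hω i j) hpos, hε⟩

/-- A graph in which `v` reaches every vertex is structurally controllable from `v`. -/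
lemma exists_pos_weights_det_ctrbMat_ne_zero {n : ℕ} (A : Matrix (Fin n) (Fin n) ℝ)
    (h01 : ∀ i j, A i j = 0 ∨ A i j = 1) (v : Fin n) (h : ∀ i, ∃ k : ℕ, (A ^ k) i v ≠ 0) :
    ∃ ω : Fin n → Fin n → ℝ, (∀ i j, 0 < ω i j) ∧
      (ctrbMat (lapOfAdjMat A ω) (Pi.single v 1)).det ≠ 0 := by
  obtain ⟨r, p, hp⟩ := A.exists_parent v h
  have hA : ∀ i, i ≠ v → A i (p i) = 1 := fun i hi => (h01 i (p i)).resolve_left (hp i hi).1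
  set d : Fin n → ℝ := fun i => if i = v then 0 else (i : ℝ) + 1 with hd
  have hdv : d v = 0 := if_pos rfl
  have hdinj : Function.Injective d := by
    intro i j hij
    simp only [hd] at hij
    split_ifs at hij with hi hj hj
    · rw [hi, hj]
    · exact absurd hij (by positivity)
    · exact absurd hij (by positivity)
    · exact Fin.ext (by exact_mod_cast add_right_cancel hij)
  have hω : ∀ i m, (if A i m = 1 then (if m = p i then d i else 0) else 0)
      = if m = p i then d i else 0 := by
    intro i m
    by_cases hm : m = p i
    · by_cases hi : i = v
      · simp [hi, hdv]
      · simp [hm, hA i hi]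
    · simp [hm]
  refine exists_pos_weights_of_nonneg A _ (fun i j => if j = p i then d i else 0) ?_ ?_
  · intro i j
    simp only [hd]
    split_ifs <;> positivity
  · refine det_ctrbMat_tree_ne_zero_s16 _ v d hdinj hdv r p (fun i hi => (hp i hi).2) ?_ ?_
    · ext j
      simp only [Matrix.single_one_vecMul, Matrix.row, lapOfAdjMat, Matrix.of_apply, hω, hdv]
      simp
    · intro i hi
      have hpi : p i ≠ i := fun h0 => absurd (hp i hi).2 (by rw [h0]; exact lt_irrefl _)
      ext j
      simp only [Matrix.single_one_vecMul, Matrix.row, lapOfAdjMat, Matrix.of_apply, hω,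
        Pi.smul_apply, Pi.sub_apply, Pi.single_apply, Finset.sum_ite_eq',
        Finset.mem_univ, if_true, smul_eq_mul]
      by_cases hij : i = j
      · subst hij
        simp [Ne.symm hpi]
      · by_cases hj : j = p i
        · simp [hj, hpi, Ne.symm hpi]
        · simp [hij, Ne.symm hij, hj]

/-- **Structural controllability of in-degree regular graphs.**
Let `A` be the adjacency matrix of an in-degree regular directed graph `G` on `n` vertices
(`A i j = 1` iff there is an edge from `j` to `i`; zero diagonal; row sums equal to the
common in-degree `d`), and set `S = A + A² + ⋯ + A^{n−1}`.  Then `G` is structurally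
controllable with a single leader — there exist a vertex `v` and positive weights on the
edges of `G` making `(L_ω, e_v)` controllable — iff some column `j` of `S` has no zero
entry off the diagonal. -/
theorem indegree_regular_structurally_controllable_iff {n : ℕ}
    (A : Matrix (Fin n) (Fin n) ℝ) (d : ℝ)
    (h01 : ∀ i j, A i j = 0 ∨ A i j = 1)
    (hdiag : ∀ i, A i i = 0)
    (hreg : ∀ i, ∑ j, A i j = d) :
    (∃ v : Fin n, ∃ ω : Fin n → Fin n → ℝ, (∀ i j, A i j = 1 → 0 < ω i j) ∧
        (ctrbMat (lapOfAdjMat A ω) (Pi.single v 1)).rank = n) ↔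
      ∃ j : Fin n, ∀ i : Fin n, i ≠ j →
        (∑ k ∈ Finset.Icc 1 (n - 1), A ^ k) i j ≠ 0 := by
  have hA : ∀ i j, 0 ≤ A i j := fun i j => by rcases h01 i j with h | h <;> simp [h]
  constructor
  · rintro ⟨v, ω, -, hrank⟩
    refine ⟨v, fun i hi => ?_⟩
    obtain ⟨k, hk, hne⟩ := exists_pow_apply_ne_zero_of_rank_ctrbMat _ v hrank i
    obtain ⟨m, hm, hpos⟩ := Matrix.exists_pow_pos_of_pow_apply_ne_zero hA
      (fun i j hij hL h0 => hL (by simp [lapOfAdjMat, hij, h0])) v k i hne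
    have hm0 : m ≠ 0 := by
      rintro rfl
      simp [Matrix.one_apply_ne hi] at hpos
    rw [Matrix.sum_apply]
    exact (Finset.sum_pos' (fun l _ => Matrix.pow_apply_nonneg hA l i v)
      ⟨m, Finset.mem_Icc.mpr ⟨by omega, by omega⟩, hpos⟩).ne'
  · rintro ⟨v, hv⟩
    have hreach : ∀ i, ∃ k : ℕ, (A ^ k) i v ≠ 0 := by
      intro i
      by_cases hi : i = v
      · exact ⟨0, by simp [hi]⟩
      · have hne := hv i hi
        rw [Matrix.sum_apply] at hne
        obtain ⟨k, -, hk⟩ := Finset.exists_ne_zero_of_sum_ne_zero hne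
        exact ⟨k, hk⟩
    obtain ⟨ω, hω, hdet⟩ := exists_pos_weights_det_ctrbMat_ne_zero A h01 v hreach
    refine ⟨v, ω, fun i j _ => hω i j, ?_⟩
    rw [Matrix.rank_of_isUnit _ ((Matrix.isUnit_iff_isUnit_det _).mpr hdet.isUnit),
      Fintype.card_fin]
end

section
/- Let 𝔽 be a field and let L ∈ 𝔽^{n×n} be lower triangular with pairwise distinct diagonal entries λ_1, …, λ_n. Then there exists an invertible lower triangular matrix P ∈ 𝔽^{n×n} with all diagonal entries equal to 1 such that P^{−1} L P = diag(λ_1, …, λ_n). -/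
open Matrix

/-- The `j`-th column of the unit lower triangular matrix diagonalizing `L`, obtained by
forward substitution. -/
def lowerTriangularEigenvector {𝔽 : Type*} [Field 𝔽] {n : ℕ}
    (L : Matrix (Fin n) (Fin n) 𝔽) (j i : Fin n) : 𝔽 :=
  if i < j then 0
  else if i = j then 1
  else (∑ k : {k // k < i}, L i k * lowerTriangularEigenvector L j k) / (L j j - L i i)
termination_by i
decreasing_by exact k.2

section

variable {𝔽 : Type*} [Field 𝔽] {n : ℕ} (L : Matrix (Fin n) (Fin n) 𝔽)

theorem lowerTriangularEigenvector_of_lt {i j : Fin n} (h : i < j) :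
    lowerTriangularEigenvector L j i = 0 := by
  rw [lowerTriangularEigenvector, if_pos h]

theorem lowerTriangularEigenvector_self (j : Fin n) :
    lowerTriangularEigenvector L j j = 1 := by
  rw [lowerTriangularEigenvector, if_neg (lt_irrefl j), if_pos rfl]

theorem lowerTriangularEigenvector_of_gt {i j : Fin n} (h : j < i) :
    lowerTriangularEigenvector L j i =
      (∑ k : {k // k < i}, L i k * lowerTriangularEigenvector L j k) / (L j j - L i i) := by
  rw [lowerTriangularEigenvector, if_neg h.not_gt, if_neg h.ne']

variable {L}

theorem mulVec_apply_of_lowerTriangular (hlow : ∀ i j : Fin n, i < j → L i j = 0)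
    (v : Fin n → 𝔽) (i : Fin n) :
    (L *ᵥ v) i = (∑ k : {k // k < i}, L i k * v k) + L i i * v i := by
  have hsub : ∑ k : {k // k < i}, L i k * v k = ∑ k ∈ Finset.Iio i, L i k * v k :=
    (Finset.sum_subtype (Finset.Iio i) (fun _ => Finset.mem_Iio) fun k => L i k * v k).symm
  rw [hsub, add_comm, ← Finset.sum_insert (f := fun k => L i k * v k) Finset.notMem_Iio_self,
    Finset.Iio_insert]
  refine (Finset.sum_subset (Finset.subset_univ (Finset.Iic i)) fun k _ hk => ?_).symm
  exact mul_eq_zero_of_left (hlow i k (by simpa using hk)) (v k)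

theorem mulVec_lowerTriangularEigenvector (hlow : ∀ i j : Fin n, i < j → L i j = 0)
    (hdist : ∀ i j : Fin n, i ≠ j → L i i ≠ L j j) (j : Fin n) :
    L *ᵥ lowerTriangularEigenvector L j = L j j • lowerTriangularEigenvector L j := by
  funext i
  rw [mulVec_apply_of_lowerTriangular hlow, Pi.smul_apply, smul_eq_mul]
  rcases lt_or_ge j i with h | h
  · have hne : L j j - L i i ≠ 0 := sub_ne_zero.mpr (hdist j i h.ne)
    have hsum := (eq_div_iff hne).mp (lowerTriangularEigenvector_of_gt L h)
    rw [← hsum]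
    ring
  · rw [Finset.sum_eq_zero fun k _ => by
      rw [lowerTriangularEigenvector_of_lt L (k.2.trans_le h), mul_zero], zero_add]
    rcases h.eq_or_lt with rfl | h
    · rfl
    · simp [lowerTriangularEigenvector_of_lt L h]

end

/-- **Diagonalization of a lower triangular matrix with distinct diagonal entries.**
Let `𝔽` be a field and `L ∈ 𝔽^{n×n}` lower triangular with pairwise distinct diagonal
entries.  Then there is an invertible lower triangular matrix `P` with all diagonal
entries `1` such that `P⁻¹ L P` is the diagonal matrix of the diagonal entries of `L`. -/
theorem lower_triangular_diagonalizable {𝔽 : Type*} [Field 𝔽] {n : ℕ}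
    (L : Matrix (Fin n) (Fin n) 𝔽)
    (hlow : ∀ i j : Fin n, i < j → L i j = 0)
    (hdist : ∀ i j : Fin n, i ≠ j → L i i ≠ L j j) :
    ∃ P : Matrix (Fin n) (Fin n) 𝔽,
      (∀ i j : Fin n, i < j → P i j = 0) ∧
      (∀ i : Fin n, P i i = 1) ∧
      IsUnit P.det ∧
      P⁻¹ * L * P = Matrix.diagonal (fun i => L i i) := by
  let P : Matrix (Fin n) (Fin n) 𝔽 := of fun i j => lowerTriangularEigenvector L j i
  have hP : ∀ i j : Fin n, i < j → P i j = 0 := fun _ _ =>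
    lowerTriangularEigenvector_of_lt L
  have hP_diag : ∀ i : Fin n, P i i = 1 := lowerTriangularEigenvector_self L
  have hdet : IsUnit P.det := by
    rw [det_of_isLowerTriangular P fun i j h => hP i j h]
    simp [hP_diag]
  have hLP : L * P = P * diagonal fun i => L i i := by
    ext i j
    rw [mul_diagonal, mul_comm]
    exact congrFun (mulVec_lowerTriangularEigenvector hlow hdist j) i
  refine ⟨P, hP, hP_diag, hdet, ?_⟩
  rw [Matrix.mul_assoc, hLP, nonsing_inv_mul_cancel_left _ _ hdet]
end

section
/- Let L ∈ ℝ^{n×n} be the Laplacian of a weighted rooted directed tree on {1,…,n} with root 1, parent map par with par(i) < i, and positive edge weights w_2, …, w_n that are pairwise distinct. Then the diagonal entries 0, w_2, …, w_n of L are pairwise distinct, so there is an invertible lower triangular P ∈ ℝ^{n×n} with unit diagonal such that P^{−1} L P = diag(0, w_2, …, w_n); and for any such P, every entry of the first column of P^{−1} is nonzero. -/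
open Matrix

namespace Matrix

/-- The eigenvector of a lower triangular matrix `M` for the eigenvalue `M j j`, normalized to have
`j`-th entry `1` and computed by forward substitution. -/
noncomputable def forwardEigenvector {n : ℕ} {K : Type*} [Field K] (M : Matrix (Fin n) (Fin n) K)
    (j i : Fin n) : K :=
  if i < j then 0 else if i = j then 1 else
    (∑ k : {k : Fin n // k < i}, M i k * forwardEigenvector M j k) / (M j j - M i i)
termination_by i
decreasing_by exact k.2

section LowerTriangular

variable {n : ℕ} {K : Type*} [Field K] {M : Matrix (Fin n) (Fin n) K}

theorem forwardEigenvector_of_lt {i j : Fin n} (h : i < j) : forwardEigenvector M j i = 0 := by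
  rw [forwardEigenvector, if_pos h]

@[simp]
theorem forwardEigenvector_self (j : Fin n) : forwardEigenvector M j j = 1 := by
  rw [forwardEigenvector]; simp

theorem forwardEigenvector_of_gt {i j : Fin n} (h : j < i) :
    forwardEigenvector M j i =
      (∑ k ∈ Finset.Iio i, M i k * forwardEigenvector M j k) / (M j j - M i i) := by
  rw [forwardEigenvector, if_neg h.not_gt, if_neg h.ne',
    ← Finset.sum_subtype (Finset.Iio i) (fun _ => Finset.mem_Iio)
      (fun k => M i k * forwardEigenvector M j k)]

theorem sum_mul_eq_sum_Iio_add_of_lowerTriangular (hM : ∀ i j, i < j → M i j = 0)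
    (v : Fin n → K) (i : Fin n) :
    ∑ k, M i k * v k = ∑ k ∈ Finset.Iio i, M i k * v k + M i i * v i := by
  have hIic : ∑ k ∈ Finset.Iic i, M i k * v k = ∑ k, M i k * v k :=
    Finset.sum_subset (Finset.subset_univ _) fun k _ hk => by
      rw [hM i k (by simpa using hk), zero_mul]
  rw [← hIic, ← Finset.Iio_insert, Finset.sum_insert (by simp), add_comm]

theorem sum_mul_forwardEigenvector (hM : ∀ i j, i < j → M i j = 0)
    (hd : ∀ i j, i ≠ j → M i i ≠ M j j) (i j : Fin n) :
    ∑ k, M i k * forwardEigenvector M j k = forwardEigenvector M j i * M j j := by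
  rw [sum_mul_eq_sum_Iio_add_of_lowerTriangular hM]
  rcases lt_or_ge j i with h | h
  · have hne : M j j - M i i ≠ 0 := sub_ne_zero.2 (hd j i h.ne)
    have hv := forwardEigenvector_of_gt (M := M) h
    rw [eq_div_iff hne] at hv
    rw [← hv]; ring
  · rw [Finset.sum_eq_zero fun k hk => by
      rw [forwardEigenvector_of_lt ((Finset.mem_Iio.1 hk).trans_le h), mul_zero]]
    rcases h.lt_or_eq with h | rfl
    · simp [forwardEigenvector_of_lt h]
    · simp

theorem det_eq_one_of_unit_lowerTriangular (hM : ∀ i j, i < j → M i j = 0)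
    (hone : ∀ i, M i i = 1) : M.det = 1 := by
  rw [det_of_isLowerTriangular M fun i j h => hM i j h]
  simp [hone]

/-- A lower triangular matrix with distinct diagonal entries is diagonalized by a lower triangular
matrix with unit diagonal. -/
theorem exists_unit_lowerTriangular_diagonalization (hM : ∀ i j, i < j → M i j = 0)
    (hd : ∀ i j, i ≠ j → M i i ≠ M j j) :
    ∃ P : Matrix (Fin n) (Fin n) K, (∀ i j, i < j → P i j = 0) ∧ (∀ i, P i i = 1) ∧
      IsUnit P.det ∧ P⁻¹ * M * P = diagonal fun i => M i i := by
  set P : Matrix (Fin n) (Fin n) K := of fun i j => forwardEigenvector M j i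
  have hlow : ∀ i j, i < j → P i j = 0 := fun i j h => forwardEigenvector_of_lt h
  have hone : ∀ i, P i i = 1 := fun i => forwardEigenvector_self i
  have hdet : IsUnit P.det := by
    rw [det_eq_one_of_unit_lowerTriangular hlow hone]; exact isUnit_one
  refine ⟨P, hlow, hone, hdet, ?_⟩
  have hMP : M * P = P * diagonal fun i => M i i := by
    ext i j
    rw [mul_diagonal, mul_apply]
    exact sum_mul_forwardEigenvector hM hd i j
  rw [Matrix.mul_assoc, hMP, nonsing_inv_mul_cancel_left _ _ hdet]

theorem inv_lowerTriangular (hM : ∀ i j, i < j → M i j = 0) (hdet : IsUnit M.det)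
    {i j : Fin n} (hij : i < j) : M⁻¹ i j = 0 := by
  have := invertibleOfIsUnitDet M hdet
  have hT : M.BlockTriangular OrderDual.toDual := fun a b h => hM a b h
  exact blockTriangular_inv_of_blockTriangular hT hij

theorem inv_diag_of_unit_lowerTriangular (hM : ∀ i j, i < j → M i j = 0)
    (hone : ∀ i, M i i = 1) (hdet : IsUnit M.det) (i : Fin n) : M⁻¹ i i = 1 := by
  have h : (M⁻¹ * M) i i = 1 := by rw [nonsing_inv_mul _ hdet, one_apply_eq]
  rw [mul_apply, Finset.sum_eq_single i, hone, mul_one] at h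
  · exact h
  · intro k _ hk
    rcases hk.lt_or_gt with hk | hk
    · rw [hM k i hk, mul_zero]
    · rw [inv_lowerTriangular hM hdet hk, zero_mul]
  · simp

end LowerTriangular

end Matrix

namespace RootedTree

variable {n : ℕ} {r : Fin n} {par : Fin n → Fin n}

/-- `IsParent r par a b` says that `b` is the parent of the non-root vertex `a`. -/
def IsParent (r : Fin n) (par : Fin n → Fin n) (a b : Fin n) : Prop := a ≠ r ∧ par a = b

theorem le_of_reflTransGen_isParent (hpar : ∀ i, i ≠ r → par i < i) {a b : Fin n}
    (h : Relation.ReflTransGen (IsParent r par) a b) : b ≤ a := by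
  induction h with
  | refl => exact le_rfl
  | tail _ h ih => exact (h.2 ▸ hpar _ h.1).le.trans ih

theorem reflTransGen_isParent_root (hpar : ∀ i, i ≠ r → par i < i) (i : Fin n) :
    Relation.ReflTransGen (IsParent r par) i r := by
  induction i using WellFoundedLT.induction with
  | ind i ih =>
    by_cases hi : i = r
    · rw [hi]
    · exact .head ⟨hi, rfl⟩ (ih _ (hpar i hi))

/-- The path from a vertex to the root enters each vertex through at most one child. -/
theorem eq_of_isParent_of_reflTransGen (hpar : ∀ i, i ≠ r → par i < i) {i a k b : Fin n}
    (ha : Relation.ReflTransGen (IsParent r par) i a)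
    (hk : Relation.ReflTransGen (IsParent r par) i k)
    (hab : IsParent r par a b) (hkb : IsParent r par k b) : a = k := by
  have key : ∀ {x y : Fin n}, IsParent r par x b → IsParent r par y b →
      Relation.ReflTransGen (IsParent r par) x y → x = y := by
    intro x y hx hy h
    rcases h.cases_head with h | ⟨c, hxc, hcy⟩
    · exact h
    · obtain rfl : b = c := hx.2.symm.trans hxc.2
      have hlt : b < y := hy.2 ▸ hpar y hy.1
      exact absurd (le_of_reflTransGen_isParent hpar hcy) hlt.not_ge
  have hu : Relator.RightUnique (IsParent r par) := fun _ _ _ h₁ h₂ => h₁.2.symm.trans h₂.2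
  rcases Relation.ReflTransGen.total_of_right_unique hu ha hk with h | h
  · exact key hab hkb h
  · exact (key hkb hab h).symm

/-- A left eigenvector of the Laplacian of a tree whose eigenvalue differs from every diagonal
entry but the `i`-th, and whose `i`-th entry is nonzero, is nonzero at the root. -/
theorem root_entry_ne_zero (hpar : ∀ i, i ≠ r → par i < i) {w d x : Fin n → ℝ} {μ : ℝ} {i : Fin n}
    (hw : ∀ k, k ≠ r → w k ≠ 0) (hd : ∀ j, j ≠ i → d j ≠ μ)
    (hx : ∀ j, ∑ k, (if k ≠ r ∧ par k = j then x k * w k else 0) = x j * (d j - μ))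
    (hi : x i ≠ 0) : x r ≠ 0 := by
  have hsupp : ∀ j, x j ≠ 0 → Relation.ReflTransGen (IsParent r par) i j := by
    intro j
    induction j using WellFoundedGT.induction with
    | ind j ih =>
      intro hj
      by_cases hji : j = i
      · rw [hji]
      · have hne := mul_ne_zero hj (sub_ne_zero.2 (hd j hji))
        rw [← hx j] at hne
        obtain ⟨k, -, hk⟩ := Finset.exists_ne_zero_of_sum_ne_zero hne
        have hkj : k ≠ r ∧ par k = j := by
          by_contra h
          exact hk (if_neg h)
        rw [if_pos hkj] at hk
        exact (ih k (hkj.2 ▸ hpar k hkj.1) (left_ne_zero_of_mul hk)).tail hkj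
  have hanc : ∀ j, Relation.ReflTransGen (IsParent r par) i j → x j ≠ 0 := by
    intro j hj
    induction hj with
    | refl => exact hi
    | @tail a b ha hab ih =>
      intro hb
      have hsum := hx b
      rw [Finset.sum_eq_single a, if_pos (show a ≠ r ∧ par a = b from hab), hb, zero_mul] at hsum
      · exact mul_ne_zero ih (hw a hab.1) hsum
      · intro k _ hka
        split_ifs with hkb
        · by_contra hne
          exact hka (eq_of_isParent_of_reflTransGen hpar ha
            (hsupp k (left_ne_zero_of_mul hne)) hab hkb).symm
        · rfl
      · simp
  exact hanc r (reflTransGen_isParent_root hpar i)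

end RootedTree

/-- **Tree Laplacian with distinct weights: first column of `P⁻¹` has no zero entry.**
Let `L` be the Laplacian of a weighted rooted directed tree on `{0, …, n−1}` with root `0`,
parent map `par` (with `par i < i` for `i ≠ 0`) and pairwise distinct positive edge weights
`w i` (`i ≠ 0`).  Then the diagonal entries `0, w 1, …, w (n−1)` of `L` are pairwise
distinct, so there exists an invertible lower triangular `P` with unit diagonal such that
`P⁻¹ L P = diag (0, w 1, …, w (n−1))`; and for any such `P`, every entry of the first
column of `P⁻¹` is nonzero. -/
theorem tree_laplacian_first_column_nonzero {n : ℕ} (hn : 0 < n)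
    (par : Fin n → Fin n) (hpar : ∀ i : Fin n, i ≠ ⟨0, hn⟩ → par i < i)
    (w : Fin n → ℝ) (hw : ∀ i : Fin n, i ≠ ⟨0, hn⟩ → 0 < w i)
    (hdist : ∀ i j : Fin n, i ≠ ⟨0, hn⟩ → j ≠ ⟨0, hn⟩ → i ≠ j → w i ≠ w j)
    (L : Matrix (Fin n) (Fin n) ℝ)
    (hL : ∀ i j, L i j = if i = (⟨0, hn⟩ : Fin n) then 0
      else if j = i then w i else if j = par i then -w i else 0) :
    (∀ i j : Fin n, i ≠ j → L i i ≠ L j j) ∧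
    (∃ P : Matrix (Fin n) (Fin n) ℝ,
      (∀ i j : Fin n, i < j → P i j = 0) ∧ (∀ i : Fin n, P i i = 1) ∧
      IsUnit P.det ∧ P⁻¹ * L * P = Matrix.diagonal (fun i => L i i)) ∧
    (∀ P : Matrix (Fin n) (Fin n) ℝ,
      (∀ i j : Fin n, i < j → P i j = 0) → (∀ i : Fin n, P i i = 1) →
      IsUnit P.det → P⁻¹ * L * P = Matrix.diagonal (fun i => L i i) →
      ∀ i : Fin n, P⁻¹ i (⟨0, hn⟩ : Fin n) ≠ 0) := by
  set r : Fin n := ⟨0, hn⟩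
  have hdr : L r r = 0 := by simp [hL]
  have hdi : ∀ i, i ≠ r → L i i = w i := fun i hi => by simp [hL, hi]
  have hlow : ∀ i j, i < j → L i j = 0 := by
    intro i j hij
    rw [hL]
    split_ifs with h₁ h₂ h₃
    · rfl
    · exact absurd h₂ hij.ne'
    · exact absurd (h₃ ▸ hpar i h₁) hij.not_gt
    · rfl
  have hd : ∀ i j, i ≠ j → L i i ≠ L j j := by
    intro i j hij
    by_cases hi : i = r
    · subst hi
      rw [hdr, hdi j hij.symm]
      exact (hw j hij.symm).ne
    · by_cases hj : j = r
      · subst hj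
        rw [hdr, hdi i hi]
        exact (hw i hi).ne'
      · rw [hdi i hi, hdi j hj]
        exact hdist i j hi hj hij
  refine ⟨hd, exists_unit_lowerTriangular_diagonalization hlow hd, ?_⟩
  intro P hP hone hdet hPL i
  have hQL : P⁻¹ * L = diagonal (fun i => L i i) * P⁻¹ := by
    rw [← hPL, mul_nonsing_inv_cancel_right _ _ hdet]
  refine RootedTree.root_entry_ne_zero (d := fun j => L j j) (μ := L i i) (i := i)
    (x := fun j => P⁻¹ i j) hpar (fun k hk => (hw k hk).ne') (fun j hj => hd j i hj) ?_ ?_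
  · intro j
    have h := congrFun (congrFun hQL i) j
    rw [diagonal_mul, mul_apply] at h
    have hsplit : ∀ k, P⁻¹ i k * L k j = (if k = j then P⁻¹ i j * L j j else 0) -
        (if k ≠ r ∧ par k = j then P⁻¹ i k * w k else 0) := by
      intro k
      by_cases hkj : k = j
      · subst hkj
        have : ¬ (k ≠ r ∧ par k = k) := fun h => (hpar k h.1).ne h.2
        rw [if_pos rfl, if_neg this, sub_zero]
      · rw [if_neg hkj, hL k j, if_neg (Ne.symm hkj)]
        by_cases hk : k = r
        · simp [hk]
        · by_cases hp : par k = j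
          · simp [hk, hp]
          · simp [hk, hp, Ne.symm hp]
    rw [Finset.sum_congr rfl fun k _ => hsplit k, Finset.sum_sub_distrib,
      Finset.sum_ite_eq' Finset.univ j, if_pos (Finset.mem_univ j)] at h
    linear_combination -h
  · simp [inv_diag_of_unit_lowerTriangular hP hone hdet i]
end
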